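/- arXiv:math/0511420 — 5 statements merged into one kernel-verified Lean document; each statement's English description precedes it below -/
import Mathlib

section
/- Fix n ≥ 3. Each of the five maps A, B, C, D, E from the Whitehouse complex Δ_n into Δ_{n+1} is injective (A and B as functions of the face F; C and D as functions of the pair (F,S) with S ∈ F; E as a function of the pair (F,i) with 2 ≤ i ≤ n), each map sends faces of Δ_n to faces of Δ_{n+1}, the images of A, B, C, D, E are pairwise disjoint, and their union is the set of all faces of Δ_{n+1}. -/
/-- `F` is a face of the Whitehouse complex `Δ_n`. -/
def IsWhFace (n : ℕ) (F : Finset (Finset ℕ)) : Prop :=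
  (∀ S ∈ F, S ⊆ Finset.Icc 2 n ∧ 2 ≤ S.card ∧ S.card ≤ n - 2) ∧
  ∀ S ∈ F, ∀ T ∈ F, S ⊆ T ∨ T ⊆ S ∨ S ∩ T = ∅

/-- `A(F) = F`. -/
def mapA (F : Finset (Finset ℕ)) : Finset (Finset ℕ) := F

/-- `B(F) = F ∪ {{2,…,n}}`. -/
def mapB (n : ℕ) (F : Finset (Finset ℕ)) : Finset (Finset ℕ) :=
  insert (Finset.Icc 2 n) F

/-- `C(F,S) = {T ∪ {n+1} : T ∈ F, S ⊆ T} ∪ {T : T ∈ F, S ⊄ T}`. -/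
def mapC (n : ℕ) (F : Finset (Finset ℕ)) (S : Finset ℕ) : Finset (Finset ℕ) :=
  (F.filter (fun T => S ⊆ T)).image (insert (n + 1)) ∪ F.filter (fun T => ¬ S ⊆ T)

/-- `D(F,S) = C(F,S) ∪ {S}`. -/
def mapD (n : ℕ) (F : Finset (Finset ℕ)) (S : Finset ℕ) : Finset (Finset ℕ) :=
  insert S (mapC n F S)

/-- `E(F,i) = {{i,n+1}} ∪ {T ∪ {n+1} : T ∈ F, i ∈ T} ∪ {T : T ∈ F, i ∉ T}`. -/
def mapE (n : ℕ) (F : Finset (Finset ℕ)) (i : ℕ) : Finset (Finset ℕ) :=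
  insert {i, n + 1}
    ((F.filter (fun T => i ∈ T)).image (insert (n + 1)) ∪ F.filter (fun T => i ∉ T))

/-- The image of `A`. -/
def imA (n : ℕ) : Set (Finset (Finset ℕ)) :=
  {G | ∃ F, IsWhFace n F ∧ G = mapA F}

/-- The image of `B`. -/
def imB (n : ℕ) : Set (Finset (Finset ℕ)) :=
  {G | ∃ F, IsWhFace n F ∧ G = mapB n F}

/-- The image of `C`, over all pairs `(F, S)` with `S ∈ F`. -/
def imC (n : ℕ) : Set (Finset (Finset ℕ)) :=
  {G | ∃ F, IsWhFace n F ∧ ∃ S ∈ F, G = mapC n F S}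

/-- The image of `D`, over all pairs `(F, S)` with `S ∈ F`. -/
def imD (n : ℕ) : Set (Finset (Finset ℕ)) :=
  {G | ∃ F, IsWhFace n F ∧ ∃ S ∈ F, G = mapD n F S}

/-- The image of `E`, over all pairs `(F, i)` with `2 ≤ i ≤ n`. -/
def imE (n : ℕ) : Set (Finset (Finset ℕ)) :=
  {G | ∃ F, IsWhFace n F ∧ ∃ i, 2 ≤ i ∧ i ≤ n ∧ G = mapE n F i}

theorem IsWhFace.succ_notMem {n : ℕ} {F : Finset (Finset ℕ)} (hF : IsWhFace n F)
    {T : Finset ℕ} (hT : T ∈ F) : n + 1 ∉ T := fun h => by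
  have := Finset.mem_Icc.1 ((hF.1 T hT).1 h)
  omega

theorem IsWhFace.mem_mapC {n : ℕ} {F : Finset (Finset ℕ)} (hF : IsWhFace n F)
    {S U : Finset ℕ} :
    U ∈ mapC n F S ↔ (n + 1 ∈ U ∧ U.erase (n + 1) ∈ F ∧ S ⊆ U.erase (n + 1)) ∨
      (n + 1 ∉ U ∧ U ∈ F ∧ ¬ S ⊆ U) := by
  simp only [mapC, Finset.mem_union, Finset.mem_image, Finset.mem_filter]
  constructor
  · rintro (⟨T, ⟨hT, hST⟩, rfl⟩ | ⟨hU, hSU⟩)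
    · left
      rw [Finset.erase_insert (hF.succ_notMem hT)]
      exact ⟨Finset.mem_insert_self _ _, hT, hST⟩
    · exact Or.inr ⟨hF.succ_notMem hU, hU, hSU⟩
  · rintro (⟨hN, hU, hSU⟩ | ⟨-, hU, hSU⟩)
    · exact Or.inl ⟨_, ⟨hU, hSU⟩, Finset.insert_erase hN⟩
    · exact Or.inr ⟨hU, hSU⟩

theorem mapE_eq (n : ℕ) (F : Finset (Finset ℕ)) (i : ℕ) :
    mapE n F i = insert (insert (n + 1) {i}) (mapC n F {i}) := by
  simp [mapE, mapC, Finset.pair_comm]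

theorem IsWhFace.mem_iff_mapC {n : ℕ} {F : Finset (Finset ℕ)} (hF : IsWhFace n F)
    (S : Finset ℕ) {T : Finset ℕ} :
    T ∈ F ↔ n + 1 ∉ T ∧ (insert (n + 1) T ∈ mapC n F S ∨ T ∈ mapC n F S) := by
  rw [hF.mem_mapC, hF.mem_mapC]
  constructor
  · intro hT
    have hN := hF.succ_notMem hT
    by_cases hS : S ⊆ T <;> simp [hN, hT, hS]
  · rintro ⟨hN, h⟩
    simp only [Finset.erase_insert hN, Finset.mem_insert_self, not_true_eq_false, false_and,
      or_false] at h
    tauto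

theorem IsWhFace.eq_of_mapC_eq {n : ℕ} {F F' : Finset (Finset ℕ)} (hF : IsWhFace n F)
    (hF' : IsWhFace n F') {S : Finset ℕ} (h : mapC n F S = mapC n F' S) : F = F' := by
  ext T
  rw [hF.mem_iff_mapC S, hF'.mem_iff_mapC S, h]

/-- `M` is the smallest member of `G` containing `N`. -/
def IsLeastThrough (N : ℕ) (G : Finset (Finset ℕ)) (M : Finset ℕ) : Prop :=
  M ∈ G ∧ N ∈ M ∧ ∀ T ∈ G, N ∈ T → M ⊆ T

theorem IsLeastThrough.unique {N : ℕ} {G : Finset (Finset ℕ)} {M M' : Finset ℕ}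
    (h : IsLeastThrough N G M) (h' : IsLeastThrough N G M') : M = M' :=
  (h.2.2 _ h'.1 h'.2.1).antisymm (h'.2.2 _ h.1 h.2.1)

theorem IsWhFace.insert_subset_of_mem_mapC {n : ℕ} {F : Finset (Finset ℕ)} (hF : IsWhFace n F)
    {S T : Finset ℕ} (hT : T ∈ mapC n F S) (hN : n + 1 ∈ T) : insert (n + 1) S ⊆ T := by
  rcases hF.mem_mapC.1 hT with ⟨_, _, h⟩ | ⟨h, _⟩
  · exact Finset.insert_subset hN (h.trans (Finset.erase_subset _ _))
  · exact absurd hN h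

theorem IsWhFace.isLeastThrough_mapC {n : ℕ} {F : Finset (Finset ℕ)} (hF : IsWhFace n F)
    {S : Finset ℕ} (hS : S ∈ F) : IsLeastThrough (n + 1) (mapC n F S) (insert (n + 1) S) := by
  refine ⟨hF.mem_mapC.2 (Or.inl ?_), Finset.mem_insert_self _ _, fun T hT hN =>
    hF.insert_subset_of_mem_mapC hT hN⟩
  rw [Finset.erase_insert (hF.succ_notMem hS)]
  exact ⟨Finset.mem_insert_self _ _, hS, subset_rfl⟩

theorem IsWhFace.isLeastThrough_mapD {n : ℕ} {F : Finset (Finset ℕ)} (hF : IsWhFace n F)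
    {S : Finset ℕ} (hS : S ∈ F) : IsLeastThrough (n + 1) (mapD n F S) (insert (n + 1) S) := by
  have h := hF.isLeastThrough_mapC hS
  refine ⟨Finset.mem_insert_of_mem h.1, h.2.1, fun T hT hN => ?_⟩
  rcases Finset.mem_insert.1 hT with rfl | hT
  · exact absurd hN (hF.succ_notMem hS)
  · exact h.2.2 T hT hN

theorem IsWhFace.isLeastThrough_mapE {n : ℕ} {F : Finset (Finset ℕ)} (hF : IsWhFace n F)
    (i : ℕ) : IsLeastThrough (n + 1) (mapE n F i) (insert (n + 1) {i}) := by
  rw [mapE_eq]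
  refine ⟨Finset.mem_insert_self _ _, Finset.mem_insert_self _ _, fun T hT hN => ?_⟩
  rcases Finset.mem_insert.1 hT with rfl | hT
  · exact subset_rfl
  · exact hF.insert_subset_of_mem_mapC hT hN

theorem IsWhFace.notMem_mapC {n : ℕ} {F : Finset (Finset ℕ)} (hF : IsWhFace n F)
    {S : Finset ℕ} (hS : S ∈ F) : S ∉ mapC n F S := fun h => by
  have := hF.succ_notMem hS
  rcases hF.mem_mapC.1 h with h | h
  · exact this h.1
  · exact h.2.2 subset_rfl

theorem IsWhFace.insert_singleton_notMem_mapC {n : ℕ} {F : Finset (Finset ℕ)}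
    (hF : IsWhFace n F) {i : ℕ} (hi : i ≤ n) : insert (n + 1) {i} ∉ mapC n F {i} := fun h => by
  have hN : n + 1 ∉ ({i} : Finset ℕ) := by simp; omega
  rcases hF.mem_mapC.1 h with h | h
  · rw [Finset.erase_insert hN] at h
    have := (hF.1 _ h.2.1).2.1
    simp at this
  · exact h.1 (Finset.mem_insert_self _ _)

theorem insert_inj_of_notMem {α : Type*} [DecidableEq α] {a : α} {S S' : Finset α}
    (hS : a ∉ S) (hS' : a ∉ S') (h : insert a S = insert a S') : S = S' := by
  rw [← Finset.erase_insert hS, h, Finset.erase_insert hS']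

theorem Icc_notMem_of_isWhFace {n : ℕ} (hn : 3 ≤ n) {F : Finset (Finset ℕ)}
    (hF : IsWhFace n F) : Finset.Icc 2 n ∉ F := fun h => by
  have := (hF.1 _ h).2.2
  rw [Nat.card_Icc] at this
  omega

theorem isWhFace_mapA {n : ℕ} {F : Finset (Finset ℕ)} (hF : IsWhFace n F) :
    IsWhFace (n + 1) (mapA F) :=
  ⟨fun S hS => by
    obtain ⟨h1, h2, h3⟩ := hF.1 S hS
    exact ⟨h1.trans (Finset.Icc_subset_Icc_right (by omega)), h2, by omega⟩, hF.2⟩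

theorem IsWhFace.insert_vertex {n : ℕ} {F : Finset (Finset ℕ)} (hF : IsWhFace n F)
    {S : Finset ℕ} (hS : S ⊆ Finset.Icc 2 n ∧ 2 ≤ S.card ∧ S.card ≤ n - 2)
    (h : ∀ T ∈ F, S ⊆ T ∨ T ⊆ S ∨ S ∩ T = ∅) : IsWhFace n (insert S F) := by
  constructor
  · intro T hT
    rcases Finset.mem_insert.1 hT with rfl | hT
    · exact hS
    · exact hF.1 T hT
  · intro T hT U hU
    rcases Finset.mem_insert.1 hT with rfl | hTF <;>
      rcases Finset.mem_insert.1 hU with rfl | hUF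
    · exact Or.inl subset_rfl
    · exact h U hUF
    · rw [Finset.inter_comm]
      have := h T hTF
      tauto
    · exact hF.2 T hTF U hUF

theorem isWhFace_mapB {n : ℕ} (hn : 3 ≤ n) {F : Finset (Finset ℕ)} (hF : IsWhFace n F) :
    IsWhFace (n + 1) (mapB n F) := by
  refine (isWhFace_mapA hF).insert_vertex
    ⟨Finset.Icc_subset_Icc_right (by omega), ?_, ?_⟩ fun T hT => Or.inr (Or.inl (hF.1 T hT).1)
  · rw [Nat.card_Icc]
    omega
  · rw [Nat.card_Icc]

theorem isWhFace_mapC {n : ℕ} (hn : 3 ≤ n) {F : Finset (Finset ℕ)} (hF : IsWhFace n F)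
    {S : Finset ℕ} (hS : S.Nonempty) : IsWhFace (n + 1) (mapC n F S) := by
  have key : ∀ T ∈ F, ∀ U ∈ F, S ⊆ T → ¬ S ⊆ U →
      U ⊆ insert (n + 1) T ∨ insert (n + 1) T ∩ U = ∅ := by
    intro T hT U hU hST hSU
    rcases hF.2 T hT U hU with h | h | h
    · exact absurd (hST.trans h) hSU
    · exact Or.inl (h.trans (Finset.subset_insert _ _))
    · right
      rw [Finset.insert_inter_of_notMem (hF.succ_notMem hU), h]
  constructor
  · intro T hT
    simp only [mapC, Finset.mem_union, Finset.mem_image, Finset.mem_filter] at hT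
    rcases hT with ⟨T, ⟨hT, -⟩, rfl⟩ | ⟨hT, -⟩
    · obtain ⟨h1, h2, h3⟩ := hF.1 T hT
      rw [Finset.card_insert_of_notMem (hF.succ_notMem hT)]
      exact ⟨Finset.insert_subset (Finset.mem_Icc.2 ⟨by omega, le_rfl⟩)
        (h1.trans (Finset.Icc_subset_Icc_right (by omega))), by omega, by omega⟩
    · exact (isWhFace_mapA hF).1 T hT
  · intro T hT U hU
    simp only [mapC, Finset.mem_union, Finset.mem_image, Finset.mem_filter] at hT hU
    rcases hT with ⟨T, ⟨hT, hST⟩, rfl⟩ | ⟨hT, hST⟩ <;>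
      rcases hU with ⟨U, ⟨hU, hSU⟩, rfl⟩ | ⟨hU, hSU⟩
    · rcases hF.2 T hT U hU with h | h | h
      · exact Or.inl (Finset.insert_subset_insert _ h)
      · exact Or.inr (Or.inl (Finset.insert_subset_insert _ h))
      · have := Finset.subset_inter hST hSU
        rw [h, Finset.subset_empty] at this
        exact absurd this hS.ne_empty
    · exact Or.inr (key T hT U hU hST hSU)
    · rw [Finset.inter_comm]
      have := key U hU T hT hSU hST
      tauto
    · exact hF.2 T hT U hU

theorem isWhFace_mapD {n : ℕ} (hn : 3 ≤ n) {F : Finset (Finset ℕ)} (hF : IsWhFace n F)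
    {S : Finset ℕ} (hS : S ∈ F) : IsWhFace (n + 1) (mapD n F S) := by
  have hne : S.Nonempty := Finset.card_pos.1 (by have := (hF.1 S hS).2.1; omega)
  refine (isWhFace_mapC hn hF hne).insert_vertex ((isWhFace_mapA hF).1 S hS) fun T hT => ?_
  rcases hF.mem_mapC.1 hT with ⟨_, _, h⟩ | ⟨_, h, _⟩
  · exact Or.inl (h.trans (Finset.erase_subset _ _))
  · exact hF.2 S hS T h

theorem isWhFace_mapE {n : ℕ} (hn : 3 ≤ n) {F : Finset (Finset ℕ)} (hF : IsWhFace n F)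
    {i : ℕ} (h2 : 2 ≤ i) (hi : i ≤ n) : IsWhFace (n + 1) (mapE n F i) := by
  have hN : n + 1 ∉ ({i} : Finset ℕ) := by simp; omega
  rw [mapE_eq]
  refine (isWhFace_mapC hn hF (Finset.singleton_nonempty i)).insert_vertex ⟨?_, ?_, ?_⟩
    fun T hT => ?_
  · intro x hx
    simp only [Finset.mem_insert, Finset.mem_singleton] at hx
    rw [Finset.mem_Icc]
    omega
  · rw [Finset.card_insert_of_notMem hN, Finset.card_singleton]
  · rw [Finset.card_insert_of_notMem hN, Finset.card_singleton]
    omega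
  · by_cases hT' : n + 1 ∈ T
    · exact Or.inl (hF.insert_subset_of_mem_mapC hT hT')
    · rcases hF.mem_mapC.1 hT with h | ⟨_, _, h⟩
      · exact absurd h.1 hT'
      · rw [Finset.singleton_subset_iff] at h
        right; right
        rw [Finset.insert_inter_of_notMem hT', Finset.singleton_inter_of_notMem h]

theorem IsWhFace.exists_isLeastThrough {n N : ℕ} {G : Finset (Finset ℕ)} (hG : IsWhFace n G)
    (h : ∃ T ∈ G, N ∈ T) : ∃ M, IsLeastThrough N G M := by
  obtain ⟨T, hT, hNT⟩ := h
  obtain ⟨M, hM, hmin⟩ := Finset.exists_min_image (G.filter (N ∈ ·)) Finset.card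
    ⟨T, Finset.mem_filter.2 ⟨hT, hNT⟩⟩
  rw [Finset.mem_filter] at hM
  refine ⟨M, hM.1, hM.2, fun U hU hNU => ?_⟩
  rcases hG.2 M hM.1 U hU with h | h | h
  · exact h
  · exact (Finset.eq_of_subset_of_card_le h (hmin U (Finset.mem_filter.2 ⟨hU, hNU⟩))).ge
  · have : N ∈ M ∩ U := Finset.mem_inter.2 ⟨hM.2, hNU⟩
    simp [h] at this

/-- Delete `N` from every member of `G`, and discard the members left with fewer than two
elements. -/
def contractFace (N : ℕ) (G : Finset (Finset ℕ)) : Finset (Finset ℕ) :=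
  (G.image fun T => T.erase N).filter fun T => 2 ≤ T.card

theorem mem_contractFace {N : ℕ} {G : Finset (Finset ℕ)} {T : Finset ℕ} :
    T ∈ contractFace N G ↔ N ∉ T ∧ (T ∈ G ∨ insert N T ∈ G) ∧ 2 ≤ T.card := by
  simp only [contractFace, Finset.mem_filter, Finset.mem_image]
  constructor
  · rintro ⟨⟨U, hU, rfl⟩, h⟩
    refine ⟨Finset.notMem_erase _ _, ?_, h⟩
    by_cases hN : N ∈ U
    · exact Or.inr (by rwa [Finset.insert_erase hN])
    · exact Or.inl (by rwa [Finset.erase_eq_of_notMem hN])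
  · rintro ⟨hN, h | h, hc⟩
    · exact ⟨⟨T, h, Finset.erase_eq_of_notMem hN⟩, hc⟩
    · exact ⟨⟨_, h, Finset.erase_insert hN⟩, hc⟩

theorem subset_Icc_of_succ_notMem {n : ℕ} {T : Finset ℕ} (hT : T ⊆ Finset.Icc 2 (n + 1))
    (hN : n + 1 ∉ T) : T ⊆ Finset.Icc 2 n := fun x hx => by
  have h1 := Finset.mem_Icc.1 (hT hx)
  have h2 : x ≠ n + 1 := fun h => hN (h ▸ hx)
  rw [Finset.mem_Icc]
  omega

theorem isWhFace_contractFace {n : ℕ} (hn : 3 ≤ n) {G : Finset (Finset ℕ)}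
    (hG : IsWhFace (n + 1) G) {M : Finset ℕ} (hM : IsLeastThrough (n + 1) G M) :
    IsWhFace n (contractFace (n + 1) G) := by
  constructor
  · intro T hT
    obtain ⟨hN, hT, hc⟩ := mem_contractFace.1 hT
    obtain ⟨hM1, hM2, hM3⟩ := hG.1 M hM.1
    rcases hT with hT | hT
    · have hTn := subset_Icc_of_succ_notMem (hG.1 T hT).1 hN
      refine ⟨hTn, hc, ?_⟩
      rcases hG.2 M hM.1 T hT with h | h | h
      · exact absurd (h hM.2.1) hN
      · have := Finset.card_lt_card (Finset.ssubset_iff_subset_ne.2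
          ⟨h, fun h => hN (h ▸ hM.2.1)⟩)
        omega
      · have hu : M ∪ T ⊆ Finset.Icc 2 (n + 1) := Finset.union_subset hM1 (hG.1 T hT).1
        have := Finset.card_le_card hu
        rw [Finset.card_union_of_disjoint (Finset.disjoint_iff_inter_eq_empty.2 h),
          Nat.card_Icc] at this
        omega
    · obtain ⟨h1, h2, h3⟩ := hG.1 _ hT
      rw [Finset.card_insert_of_notMem hN] at h3
      exact ⟨subset_Icc_of_succ_notMem ((Finset.subset_insert _ _).trans h1) hN, hc, by omega⟩
  · intro T hT U hU
    simp only [contractFace, Finset.mem_filter, Finset.mem_image] at hT hU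
    obtain ⟨⟨T, hT, rfl⟩, -⟩ := hT
    obtain ⟨⟨U, hU, rfl⟩, -⟩ := hU
    rcases hG.2 T hT U hU with h | h | h
    · exact Or.inl (Finset.erase_subset_erase _ h)
    · exact Or.inr (Or.inl (Finset.erase_subset_erase _ h))
    · right; right
      rw [← Finset.subset_empty, ← h]
      exact Finset.inter_subset_inter (Finset.erase_subset _ _) (Finset.erase_subset _ _)

theorem mem_mapC_contractFace {n : ℕ} (hn : 3 ≤ n) {G : Finset (Finset ℕ)}
    (hG : IsWhFace (n + 1) G) {S : Finset ℕ} (hN : n + 1 ∉ S)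
    (hM : IsLeastThrough (n + 1) G (insert (n + 1) S)) {U : Finset ℕ}
    (hUM : U ≠ insert (n + 1) S) (hUS : U ≠ S) :
    U ∈ mapC n (contractFace (n + 1) G) S ↔ U ∈ G := by
  have hsub : ∀ T ∈ G, n + 1 ∉ T → S ⊆ T → T = S := by
    intro T hT hNT hST
    rcases hG.2 _ hM.1 T hT with h | h | h
    · exact absurd (h (Finset.mem_insert_self _ _)) hNT
    · rw [Finset.subset_insert_iff_of_notMem hNT] at h
      exact h.antisymm hST
    · rw [Finset.insert_inter_of_notMem hNT, Finset.inter_eq_left.2 hST] at h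
      have := (hG.1 _ hM.1).2.1
      simp [h] at this
  rw [(isWhFace_contractFace hn hG hM).mem_mapC, mem_contractFace, mem_contractFace]
  constructor
  · rintro (⟨hU, ⟨h1, h | h, h2⟩, h3⟩ | ⟨hU, ⟨-, h | h, h2⟩, h3⟩)
    · rw [← hsub _ h h1 h3, Finset.insert_erase hU] at hUM
      exact absurd rfl hUM
    · rwa [Finset.insert_erase hU] at h
    · exact h
    · have := hM.2.2 _ h (Finset.mem_insert_self _ _)
      rw [Finset.insert_subset_insert_iff hN] at this
      exact absurd this h3
  · intro hU
    by_cases hNU : n + 1 ∈ U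
    · have hMU := hM.2.2 U hU hNU
      have hlt := Finset.card_lt_card (Finset.ssubset_iff_subset_ne.2 ⟨hMU, hUM.symm⟩)
      have h2 := (hG.1 _ hM.1).2.1
      refine Or.inl ⟨hNU, ⟨Finset.notMem_erase _ _, Or.inr ?_, ?_⟩, ?_⟩
      · rwa [Finset.insert_erase hNU]
      · rw [Finset.card_erase_of_mem hNU]
        omega
      · exact Finset.subset_erase.2 ⟨(Finset.subset_insert _ _).trans hMU, hN⟩
    · exact Or.inr ⟨hNU, ⟨hNU, Or.inl hU, (hG.1 U hU).2.1⟩, fun h => hUS (hsub U hU hNU h)⟩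

theorem mem_imC_or_imD_or_imE {n : ℕ} (hn : 3 ≤ n) {G : Finset (Finset ℕ)}
    (hG : IsWhFace (n + 1) G) {S : Finset ℕ} (hN : n + 1 ∉ S)
    (hM : IsLeastThrough (n + 1) G (insert (n + 1) S)) : G ∈ imC n ∨ G ∈ imD n ∨ G ∈ imE n := by
  have hF := isWhFace_contractFace hn hG hM
  have hne : S ≠ insert (n + 1) S := fun h => hN (h ▸ Finset.mem_insert_self _ _)
  obtain ⟨h1, h2, -⟩ := hG.1 _ hM.1
  rw [Finset.card_insert_of_notMem hN] at h2
  by_cases hc : 2 ≤ S.card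
  · have hS : S ∈ contractFace (n + 1) G := mem_contractFace.2 ⟨hN, Or.inr hM.1, hc⟩
    by_cases hSG : S ∈ G
    · refine Or.inr (Or.inl ⟨_, hF, S, hS, ?_⟩)
      ext U
      rw [mapD, Finset.mem_insert]
      by_cases hUS : U = S
      · simp [hUS, hSG]
      by_cases hUM : U = insert (n + 1) S
      · simp [hUM, hM.1, (hF.isLeastThrough_mapC hS).1]
      rw [mem_mapC_contractFace hn hG hN hM hUM hUS]
      simp [hUS]
    · refine Or.inl ⟨_, hF, S, hS, ?_⟩
      ext U
      by_cases hUS : U = S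
      · simp [hUS, hSG, hF.notMem_mapC hS]
      by_cases hUM : U = insert (n + 1) S
      · simp [hUM, hM.1, (hF.isLeastThrough_mapC hS).1]
      rw [mem_mapC_contractFace hn hG hN hM hUM hUS]
  · obtain ⟨i, rfl⟩ := Finset.card_eq_one.1 (show S.card = 1 by omega)
    have hi := Finset.mem_Icc.1 (h1 (Finset.mem_insert_of_mem (Finset.mem_singleton_self i)))
    rw [Finset.mem_singleton] at hN
    refine Or.inr (Or.inr ⟨_, hF, i, hi.1, by omega, ?_⟩)
    ext U
    rw [mapE_eq, Finset.mem_insert]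
    by_cases hUS : U = {i}
    · subst hUS
      have hUG : {i} ∉ G := fun h => by simpa using (hG.1 _ h).2.1
      have hUC : {i} ∉ mapC n (contractFace (n + 1) G) {i} := fun h => by
        rcases hF.mem_mapC.1 h with h | h
        · exact hN (Finset.mem_singleton.1 h.1)
        · exact h.2.2 subset_rfl
      tauto
    by_cases hUM : U = insert (n + 1) {i}
    · simp [hUM, hM.1]
    rw [mem_mapC_contractFace hn hG (by simpa using hN) hM hUM hUS]
    tauto

theorem mem_imA_or_imB {n : ℕ} {G : Finset (Finset ℕ)} (hG : IsWhFace (n + 1) G)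
    (h : ∀ T ∈ G, n + 1 ∉ T) : G ∈ imA n ∨ G ∈ imB n := by
  have hF : IsWhFace n (G.erase (Finset.Icc 2 n)) := by
    refine ⟨fun T hT => ?_, fun T hT U hU =>
      hG.2 T (Finset.mem_of_mem_erase hT) U (Finset.mem_of_mem_erase hU)⟩
    obtain ⟨hne, hT⟩ := Finset.mem_erase.1 hT
    obtain ⟨h1, h2, -⟩ := hG.1 T hT
    have hTn := subset_Icc_of_succ_notMem h1 (h T hT)
    have := Finset.card_lt_card (Finset.ssubset_iff_subset_ne.2 ⟨hTn, hne⟩)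
    rw [Nat.card_Icc] at this
    exact ⟨hTn, h2, by omega⟩
  by_cases hI : Finset.Icc 2 n ∈ G
  · exact Or.inr ⟨_, hF, (Finset.insert_erase hI).symm⟩
  · rw [Finset.erase_eq_of_notMem hI] at hF
    exact Or.inl ⟨_, hF, rfl⟩

theorem not_isLeastThrough_of_mem_imA {n : ℕ} {G : Finset (Finset ℕ)} (hG : G ∈ imA n)
    {M : Finset ℕ} : ¬ IsLeastThrough (n + 1) G M := by
  obtain ⟨F, hF, rfl⟩ := hG
  exact fun h => hF.succ_notMem h.1 h.2.1

theorem not_isLeastThrough_of_mem_imB {n : ℕ} {G : Finset (Finset ℕ)} (hG : G ∈ imB n)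
    {M : Finset ℕ} : ¬ IsLeastThrough (n + 1) G M := by
  obtain ⟨F, hF, rfl⟩ := hG
  rintro ⟨hM, hN, -⟩
  rcases Finset.mem_insert.1 hM with rfl | hM
  · have := Finset.mem_Icc.1 hN
    omega
  · exact hF.succ_notMem hM hN

theorem mapC_injective {n : ℕ} {F F' : Finset (Finset ℕ)} (hF : IsWhFace n F)
    (hF' : IsWhFace n F') {S S' : Finset ℕ} (hS : S ∈ F) (hS' : S' ∈ F')
    (h : mapC n F S = mapC n F' S') : F = F' ∧ S = S' := by
  obtain rfl : S = S' := insert_inj_of_notMem (hF.succ_notMem hS) (hF'.succ_notMem hS')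
    ((hF.isLeastThrough_mapC hS).unique (h ▸ hF'.isLeastThrough_mapC hS'))
  exact ⟨hF.eq_of_mapC_eq hF' h, rfl⟩

theorem mapD_injective {n : ℕ} {F F' : Finset (Finset ℕ)} (hF : IsWhFace n F)
    (hF' : IsWhFace n F') {S S' : Finset ℕ} (hS : S ∈ F) (hS' : S' ∈ F')
    (h : mapD n F S = mapD n F' S') : F = F' ∧ S = S' := by
  obtain rfl : S = S' := insert_inj_of_notMem (hF.succ_notMem hS) (hF'.succ_notMem hS')
    ((hF.isLeastThrough_mapD hS).unique (h ▸ hF'.isLeastThrough_mapD hS'))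
  exact ⟨hF.eq_of_mapC_eq hF'
    (insert_inj_of_notMem (hF.notMem_mapC hS) (hF'.notMem_mapC hS') h), rfl⟩

theorem mapE_injective {n : ℕ} {F F' : Finset (Finset ℕ)} (hF : IsWhFace n F)
    (hF' : IsWhFace n F') {i i' : ℕ} (hi : i ≤ n) (hi' : i' ≤ n)
    (h : mapE n F i = mapE n F' i') : F = F' ∧ i = i' := by
  obtain rfl : i = i' := Finset.singleton_injective (insert_inj_of_notMem
    (by simp; omega) (by simp; omega)
    ((hF.isLeastThrough_mapE i).unique (h ▸ hF'.isLeastThrough_mapE i')))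
  rw [mapE_eq, mapE_eq] at h
  exact ⟨hF.eq_of_mapC_eq hF' (insert_inj_of_notMem (hF.insert_singleton_notMem_mapC hi)
    (hF'.insert_singleton_notMem_mapC hi) h), rfl⟩

theorem IsWhFace.not_isLeastThrough_pair {n : ℕ} {F G : Finset (Finset ℕ)}
    (hF : IsWhFace n F) {S : Finset ℕ} (hS : S ∈ F) {i : ℕ} (hi : i ≤ n)
    (hG : IsLeastThrough (n + 1) G (insert (n + 1) S)) :
    ¬ IsLeastThrough (n + 1) G (insert (n + 1) {i}) := fun h => by
  have := (hF.1 S hS).2.1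
  rw [insert_inj_of_notMem (hF.succ_notMem hS) (by simp; omega) (hG.unique h)] at this
  simp at this

theorem stmt9 (n : ℕ) (hn : 3 ≤ n) :
    -- each map sends faces of `Δ_n` to faces of `Δ_{n+1}`
    (∀ F : Finset (Finset ℕ), IsWhFace n F →
      IsWhFace (n + 1) (mapA F) ∧ IsWhFace (n + 1) (mapB n F) ∧
      (∀ S ∈ F, IsWhFace (n + 1) (mapC n F S) ∧ IsWhFace (n + 1) (mapD n F S)) ∧
      (∀ i : ℕ, 2 ≤ i → i ≤ n → IsWhFace (n + 1) (mapE n F i))) ∧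
    -- each map is injective
    (∀ F F' : Finset (Finset ℕ), IsWhFace n F → IsWhFace n F' →
      (mapA F = mapA F' → F = F') ∧
      (mapB n F = mapB n F' → F = F') ∧
      (∀ S ∈ F, ∀ S' ∈ F', mapC n F S = mapC n F' S' → F = F' ∧ S = S') ∧
      (∀ S ∈ F, ∀ S' ∈ F', mapD n F S = mapD n F' S' → F = F' ∧ S = S') ∧
      (∀ i i' : ℕ, 2 ≤ i → i ≤ n → 2 ≤ i' → i' ≤ n →
        mapE n F i = mapE n F' i' → F = F' ∧ i = i')) ∧
    -- the images are pairwise disjoint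
    (Disjoint (imA n) (imB n) ∧ Disjoint (imA n) (imC n) ∧ Disjoint (imA n) (imD n) ∧
      Disjoint (imA n) (imE n) ∧ Disjoint (imB n) (imC n) ∧ Disjoint (imB n) (imD n) ∧
      Disjoint (imB n) (imE n) ∧ Disjoint (imC n) (imD n) ∧ Disjoint (imC n) (imE n) ∧
      Disjoint (imD n) (imE n)) ∧
    -- and their union is the set of all faces of `Δ_{n+1}`
    (imA n ∪ imB n ∪ imC n ∪ imD n ∪ imE n =
      {G : Finset (Finset ℕ) | IsWhFace (n + 1) G}) := by
  refine ⟨fun F hF => ⟨isWhFace_mapA hF, isWhFace_mapB hn hF, fun S hS =>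
      ⟨isWhFace_mapC hn hF (Finset.card_pos.1 (by have := (hF.1 S hS).2.1; omega)),
        isWhFace_mapD hn hF hS⟩, fun i h2 hi => isWhFace_mapE hn hF h2 hi⟩,
    fun F F' hF hF' => ⟨id, fun h => insert_inj_of_notMem (Icc_notMem_of_isWhFace hn hF)
        (Icc_notMem_of_isWhFace hn hF') h,
      fun S hS S' hS' => mapC_injective hF hF' hS hS',
      fun S hS S' hS' => mapD_injective hF hF' hS hS',
      fun i i' _ hi _ hi' => mapE_injective hF hF' hi hi'⟩, ?_, ?_⟩
  · simp only [Set.disjoint_left]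
    refine ⟨?_, ?_, ?_, ?_, ?_, ?_, ?_, ?_, ?_, ?_⟩
    · rintro G ⟨F, hF, hA⟩ ⟨F', hF', hB⟩
      refine Icc_notMem_of_isWhFace hn hF ?_
      rw [show F = mapB n F' from hA.symm.trans hB]
      exact Finset.mem_insert_self _ _
    · rintro _ hA ⟨F, hF, S, hS, rfl⟩
      exact not_isLeastThrough_of_mem_imA hA (hF.isLeastThrough_mapC hS)
    · rintro _ hA ⟨F, hF, S, hS, rfl⟩
      exact not_isLeastThrough_of_mem_imA hA (hF.isLeastThrough_mapD hS)
    · rintro _ hA ⟨F, hF, i, -, -, rfl⟩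
      exact not_isLeastThrough_of_mem_imA hA (hF.isLeastThrough_mapE i)
    · rintro _ hB ⟨F, hF, S, hS, rfl⟩
      exact not_isLeastThrough_of_mem_imB hB (hF.isLeastThrough_mapC hS)
    · rintro _ hB ⟨F, hF, S, hS, rfl⟩
      exact not_isLeastThrough_of_mem_imB hB (hF.isLeastThrough_mapD hS)
    · rintro _ hB ⟨F, hF, i, -, -, rfl⟩
      exact not_isLeastThrough_of_mem_imB hB (hF.isLeastThrough_mapE i)
    · rintro _ ⟨F, hF, S, hS, rfl⟩ ⟨F', hF', S', hS', h⟩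
      obtain rfl : S = S' := insert_inj_of_notMem (hF.succ_notMem hS) (hF'.succ_notMem hS')
        ((hF.isLeastThrough_mapC hS).unique (h ▸ hF'.isLeastThrough_mapD hS'))
      exact hF.notMem_mapC hS (h ▸ Finset.mem_insert_self _ _)
    · rintro _ ⟨F, hF, S, hS, rfl⟩ ⟨F', hF', i, -, hi, h⟩
      exact hF.not_isLeastThrough_pair hS hi (hF.isLeastThrough_mapC hS)
        (h ▸ hF'.isLeastThrough_mapE i)
    · rintro _ ⟨F, hF, S, hS, rfl⟩ ⟨F', hF', i, -, hi, h⟩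
      exact hF.not_isLeastThrough_pair hS hi (hF.isLeastThrough_mapD hS)
        (h ▸ hF'.isLeastThrough_mapE i)
  · ext G
    simp only [Set.mem_union, Set.mem_ofPred_eq]
    constructor
    · rintro ((((⟨F, hF, rfl⟩ | ⟨F, hF, rfl⟩) | ⟨F, hF, S, hS, rfl⟩) | ⟨F, hF, S, hS, rfl⟩) |
        ⟨F, hF, i, h2, hi, rfl⟩)
      · exact isWhFace_mapA hF
      · exact isWhFace_mapB hn hF
      · exact isWhFace_mapC hn hF (Finset.card_pos.1 (by have := (hF.1 S hS).2.1; omega))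
      · exact isWhFace_mapD hn hF hS
      · exact isWhFace_mapE hn hF h2 hi
    · intro hG
      by_cases h : ∃ T ∈ G, n + 1 ∈ T
      · obtain ⟨M, hM⟩ := hG.exists_isLeastThrough h
        rw [← Finset.insert_erase hM.2.1] at hM
        have := mem_imC_or_imD_or_imE hn hG (Finset.notMem_erase _ _) hM
        tauto
      · push Not at h
        have := mem_imA_or_imB hG h
        tauto
end

section
/- Fix n ≥ 3 and an element i with 2 ≤ i ≤ n. The map F ↦ E(F,i) is a bijection from the set of faces of the Whitehouse complex Δ_n onto the set of faces of Δ_{n+1} that contain the vertex {i, n+1}; this bijection is an isomorphism of posets (F ⊆ F′ if and only if E(F,i) ⊆ E(F′,i)); and its image, the set of faces of Δ_{n+1} containing {i, n+1}, is an upper order ideal of the face poset of Δ_{n+1}. -/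
namespace IsWhFace

variable {n i : ℕ} {F F' G : Finset (Finset ℕ)} {S T : Finset ℕ}

theorem succ_notMem_s10 (hF : IsWhFace n F) (hT : T ∈ F) : n + 1 ∉ T := by
  intro h
  have := Finset.mem_Icc.1 ((hF.1 T hT).1 h)
  omega

theorem mem_mapE_iff (hF : IsWhFace n F) (hin : i ≤ n) :
    S ∈ mapE n F i ↔
      S = {i, n + 1} ∨ (S.erase (n + 1) ∈ F ∧ (n + 1 ∈ S ↔ i ∈ S)) := by
  have hne : i ≠ n + 1 := by omega
  simp only [mapE, Finset.mem_insert, Finset.mem_union, Finset.mem_image, Finset.mem_filter]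
  refine or_congr_right ⟨?_, ?_⟩
  · rintro (⟨T, ⟨hT, hi⟩, rfl⟩ | ⟨hS, hi⟩)
    · simp [Finset.erase_insert (hF.succ_notMem_s10 hT), hT, hi]
    · simp [hF.succ_notMem_s10 hS, hS, hi]
  · rintro ⟨hS, h⟩
    by_cases hi : i ∈ S
    · exact .inl ⟨S.erase (n + 1), ⟨hS, Finset.mem_erase.2 ⟨hne, hi⟩⟩,
        Finset.insert_erase (h.2 hi)⟩
    · rw [Finset.erase_eq_of_notMem (mt h.1 hi)] at hS
      exact .inr ⟨hS, hi⟩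

theorem mapE_isWhFace (hF : IsWhFace n F) (hn : 3 ≤ n) (hi2 : 2 ≤ i) (hin : i ≤ n) :
    IsWhFace (n + 1) (mapE n F i) := by
  have hne : i ≠ n + 1 := by omega
  have pair : ∀ S : Finset ℕ, (n + 1 ∈ S ↔ i ∈ S) →
      ({i, n + 1} : Finset ℕ) ⊆ S ∨ ({i, n + 1} : Finset ℕ) ∩ S = ∅ := by
    intro S h
    by_cases hi : i ∈ S
    · exact .inl (by simp [Finset.insert_subset_iff, hi, h.2 hi])
    · refine .inr ?_
      simp [Finset.insert_inter_of_notMem, hi, mt h.1 hi]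
  refine ⟨fun S hS => ?_, fun S hS T hT => ?_⟩
  · rcases (hF.mem_mapE_iff hin).1 hS with rfl | ⟨hS, -⟩
    · rw [Finset.card_pair hne]
      refine ⟨?_, le_rfl, by omega⟩
      simp only [Finset.insert_subset_iff, Finset.singleton_subset_iff, Finset.mem_Icc]
      omega
    · obtain ⟨hsub, h2, hle⟩ := hF.1 _ hS
      have h1 := Finset.card_erase_le (s := S) (a := n + 1)
      have h3 := Finset.pred_card_le_card_erase (s := S) (a := n + 1)
      refine ⟨fun x hx => ?_, by omega, by omega⟩
      by_cases hxn : x = n + 1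
      · exact Finset.mem_Icc.2 (by omega)
      · have := Finset.mem_Icc.1 (hsub (Finset.mem_erase.2 ⟨hxn, hx⟩))
        exact Finset.mem_Icc.2 (by omega)
  · rcases (hF.mem_mapE_iff hin).1 hS with rfl | ⟨hS, hSi⟩ <;>
      rcases (hF.mem_mapE_iff hin).1 hT with rfl | ⟨hT, hTi⟩
    · exact .inl subset_rfl
    · rcases pair T hTi with h | h <;> tauto
    · rw [Finset.inter_comm]
      rcases pair S hSi with h | h <;> tauto
    · have := hF.2 _ hS _ hT
      simp only [Finset.subset_iff, Finset.eq_empty_iff_forall_notMem, Finset.mem_inter,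
        Finset.mem_erase] at this ⊢
      grind

theorem mapE_subset_mapE_iff (hF : IsWhFace n F) (hF' : IsWhFace n F') (hin : i ≤ n) :
    F ⊆ F' ↔ mapE n F i ⊆ mapE n F' i := by
  have hne : i ≠ n + 1 := by omega
  refine ⟨fun h S hS => ?_, fun h T hT => ?_⟩
  · rw [hF.mem_mapE_iff hin] at hS
    exact (hF'.mem_mapE_iff hin).2 (hS.imp_right fun hS => ⟨h hS.1, hS.2⟩)
  · have hnT := hF.succ_notMem_s10 hT
    have hcard := (hF.1 T hT).2.1
    by_cases hi : i ∈ T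
    · have key := h ((hF.mem_mapE_iff hin (S := insert (n + 1) T)).2
        (.inr (by simp [Finset.erase_insert hnT, hT, hi])))
      rcases (hF'.mem_mapE_iff hin).1 key with heq | ⟨hmem, -⟩
      · have := congrArg Finset.card heq
        rw [Finset.card_insert_of_notMem hnT, Finset.card_pair hne] at this
        omega
      · rwa [Finset.erase_insert hnT] at hmem
    · have key := h ((hF.mem_mapE_iff hin (S := T)).2
        (.inr (by simp [hT, hi, hnT])))
      rcases (hF'.mem_mapE_iff hin).1 key with rfl | ⟨hmem, -⟩
      · simp at hi
      · rwa [Finset.erase_eq_of_notMem hnT] at hmem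

theorem mem_iff_of_pair_mem (hG : IsWhFace (n + 1) G) (hp : {i, n + 1} ∈ G) (hin : i ≤ n)
    (hS : S ∈ G) : n + 1 ∈ S ↔ i ∈ S := by
  have hne : i ≠ n + 1 := by omega
  rcases hG.2 _ hS _ hp with h | h | h
  · rw [Finset.eq_of_subset_of_card_le h
      ((Finset.card_pair hne).trans_le (hG.1 S hS).2.1)]
    simp
  · simp [h (show i ∈ _ by simp), h (show n + 1 ∈ _ by simp)]
  · simp only [Finset.eq_empty_iff_forall_notMem, Finset.mem_inter] at h
    have h1 := h i
    have h2 := h (n + 1)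
    simp_all

theorem exists_mapE_eq (hG : IsWhFace (n + 1) G) (hp : {i, n + 1} ∈ G) (hi2 : 2 ≤ i)
    (hin : i ≤ n) : ∃ F, IsWhFace n F ∧ mapE n F i = G := by
  have hne : i ≠ n + 1 := by omega
  have hF : IsWhFace n ((G.erase {i, n + 1}).image fun S => S.erase (n + 1)) := by
    simp only [IsWhFace, Finset.forall_mem_image, Finset.mem_erase, and_imp]
    refine ⟨fun S hSne hS => ?_, fun S _ hS T _ hT => ?_⟩
    · obtain ⟨hsub, h2, hle⟩ := hG.1 S hS
      have hsub' : S.erase (n + 1) ⊆ Finset.Icc 2 n := by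
        intro x hx
        rw [Finset.mem_erase] at hx
        have := Finset.mem_Icc.1 (hsub hx.2)
        exact Finset.mem_Icc.2 (by omega)
      have hiff := hG.mem_iff_of_pair_mem hp hin hS
      refine ⟨hsub', ?_⟩
      by_cases hi : i ∈ S
      · have hps : ({i, n + 1} : Finset ℕ) ⊂ S :=
          Finset.ssubset_iff_subset_ne.2
            ⟨by simp [Finset.insert_subset_iff, hi, hiff.2 hi], hSne.symm⟩
        have := Finset.card_lt_card hps
        rw [Finset.card_pair hne] at this
        rw [Finset.card_erase_of_mem (hiff.2 hi)]
        omega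
      · rw [Finset.erase_eq_of_notMem (mt hiff.1 hi)] at hsub' ⊢
        have hc := Finset.card_le_card (Finset.subset_erase.2 ⟨hsub', hi⟩)
        rw [Finset.card_erase_of_mem (Finset.mem_Icc.2 ⟨hi2, hin⟩), Nat.card_Icc] at hc
        omega
    · rcases hG.2 S hS T hT with h | h | h
      · exact .inl (Finset.erase_subset_erase _ h)
      · exact .inr (.inl (Finset.erase_subset_erase _ h))
      · refine .inr (.inr (Finset.subset_empty.1 (h ▸ ?_)))
        exact Finset.inter_subset_inter (Finset.erase_subset _ _) (Finset.erase_subset _ _)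
  refine ⟨_, hF, Finset.ext fun S => ?_⟩
  rw [hF.mem_mapE_iff hin]
  constructor
  · rintro (rfl | ⟨hS, hSi⟩)
    · exact hp
    · obtain ⟨T, hT, hTS⟩ := Finset.mem_image.1 hS
      have hTG := Finset.mem_of_mem_erase hT
      have hTi := hG.mem_iff_of_pair_mem hp hin hTG
      suffices T = S from this ▸ hTG
      have hmem : ∀ x, x ≠ n + 1 → (x ∈ T ↔ x ∈ S) := fun x hx => by
        simpa [hx] using Finset.ext_iff.1 hTS x
      ext x
      by_cases hx : x = n + 1
      · rw [hx, hTi, hSi, hmem i hne]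
      · exact hmem x hx
  · intro hS
    by_cases hSp : S = {i, n + 1}
    · exact .inl hSp
    · exact .inr ⟨Finset.mem_image_of_mem _ (Finset.mem_erase.2 ⟨hSp, hS⟩),
        hG.mem_iff_of_pair_mem hp hin hS⟩

end IsWhFace

theorem stmt10 (n : ℕ) (hn : 3 ≤ n) (i : ℕ) (hi2 : 2 ≤ i) (hin : i ≤ n) :
    -- `E(·,i)` maps faces of `Δ_n` to faces of `Δ_{n+1}` containing the vertex `{i,n+1}`
    (∀ F : Finset (Finset ℕ), IsWhFace n F →
      IsWhFace (n + 1) (mapE n F i) ∧ ({i, n + 1} : Finset ℕ) ∈ mapE n F i) ∧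
    -- it is injective on faces
    (∀ F F' : Finset (Finset ℕ), IsWhFace n F → IsWhFace n F' →
      mapE n F i = mapE n F' i → F = F') ∧
    -- and surjective onto the faces of `Δ_{n+1}` containing `{i,n+1}`
    (∀ G : Finset (Finset ℕ), IsWhFace (n + 1) G → ({i, n + 1} : Finset ℕ) ∈ G →
      ∃ F : Finset (Finset ℕ), IsWhFace n F ∧ mapE n F i = G) ∧
    -- it is an isomorphism of posets
    (∀ F F' : Finset (Finset ℕ), IsWhFace n F → IsWhFace n F' →
      (F ⊆ F' ↔ mapE n F i ⊆ mapE n F' i)) ∧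
    -- and its image is an upper order ideal of the face poset of `Δ_{n+1}`
    (∀ G G' : Finset (Finset ℕ), IsWhFace (n + 1) G → IsWhFace (n + 1) G' →
      ({i, n + 1} : Finset ℕ) ∈ G → G ⊆ G' → ({i, n + 1} : Finset ℕ) ∈ G') := by
  refine ⟨fun F hF => ⟨hF.mapE_isWhFace hn hi2 hin, Finset.mem_insert_self _ _⟩,
    fun F F' hF hF' h => ?_, fun G hG hp => hG.exists_mapE_eq hp hi2 hin,
    fun F F' hF hF' => hF.mapE_subset_mapE_iff hF' hin, fun G G' _ _ hp h => h hp⟩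
  exact Finset.Subset.antisymm ((hF.mapE_subset_mapE_iff hF' hin).2 h.subset)
    ((hF'.mapE_subset_mapE_iff hF hin).2 h.superset)
end

section
/- For every integer n ≥ 3 there exists a Morse matching M on the face poset of the Whitehouse complex Δ_n (faces ordered by inclusion, including the empty face) such that exactly (n−2)! faces are critical (unmatched by M), and every critical face has exactly n−3 elements, i.e., is a facet of dimension n−4. (Consequently, by discrete Morse theory, Δ_n is homotopy equivalent to a wedge of (n−2)! spheres of dimension n−4.) -/
open Finset

namespace Whitehouse

theorem _root_.IsWhFace.mono {n : ℕ} {F G : Finset (Finset ℕ)} (hF : IsWhFace n F) (h : G ⊆ F) :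
    IsWhFace n G :=
  ⟨fun S hS => hF.1 S (h hS), fun S hS T hT => hF.2 S (h hS) T (h hT)⟩

theorem _root_.IsWhFace.subset_powerset {n : ℕ} {F : Finset (Finset ℕ)} (hF : IsWhFace n F) :
    F ⊆ (Icc 2 n).powerset :=
  fun S hS => mem_powerset.2 (hF.1 S hS).1

theorem finite_setOf_isWhFace (n : ℕ) : {F | IsWhFace n F}.Finite :=
  (finite_toSet (Icc 2 n).powerset.powerset).subset fun _ hF =>
    mem_coe.2 (mem_powerset.2 hF.subset_powerset)

/-! ### Faces containing a pair `{n + 1, b}` -/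

/-- Extend a cluster on `{2, …, n}` by the new leaf `n + 1`, glued to the leaf `b`. -/
def liftCluster (n b : ℕ) (C : Finset ℕ) : Finset ℕ :=
  if b ∈ C then insert (n + 1) C else C

/-- Replace the leaf `b` of a tree on `{2, …, n}` by the cherry `{n + 1, b}`. -/
def lift (n b : ℕ) (G : Finset (Finset ℕ)) : Finset (Finset ℕ) :=
  insert {n + 1, b} (G.image (liftCluster n b))

/-- Delete the leaf `n + 1` from a tree on `{2, …, n + 1}`. -/
def contract (n : ℕ) (F : Finset (Finset ℕ)) : Finset (Finset ℕ) :=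
  (F.image (·.erase (n + 1))).filter (2 ≤ ·.card)

/-- The face contains some pair `{n + 1, b}`. -/
def HasCherry (n : ℕ) (F : Finset (Finset ℕ)) : Prop :=
  ∃ b ∈ Icc 2 n, {n + 1, b} ∈ F

theorem notMem_of_subset_Icc {n : ℕ} {C : Finset ℕ} (h : C ⊆ Icc 2 n) : n + 1 ∉ C := fun hC => by
  have := mem_Icc.1 (h hC)
  omega

theorem liftCluster_erase {n b : ℕ} {C : Finset ℕ} (h : n + 1 ∉ C) :
    (liftCluster n b C).erase (n + 1) = C := by
  unfold liftCluster
  split_ifs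
  · exact erase_insert h
  · exact erase_eq_of_notMem h

theorem liftCluster_ne {n b : ℕ} {C : Finset ℕ} (h : n + 1 ∉ C) (hC : 2 ≤ C.card) :
    liftCluster n b C ≠ {n + 1, b} := fun e => by
  have h1 : C ⊆ {b} := by
    rw [← liftCluster_erase (b := b) h, e]
    intro x
    simp only [mem_erase, mem_insert, mem_singleton]
    tauto
  have := card_le_card h1
  rw [card_singleton] at this
  omega

theorem liftCluster_injOn (n b : ℕ) : Set.InjOn (liftCluster n b) {C | n + 1 ∉ C} :=
  fun C hC D hD h => by
    rw [← liftCluster_erase (b := b) hC, h, liftCluster_erase hD]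

theorem contract_lift {n b : ℕ} {G : Finset (Finset ℕ)} (hG : IsWhFace n G) :
    contract n (lift n b G) = G := by
  ext C
  simp only [contract, lift, mem_filter, mem_image, mem_insert]
  constructor
  · rintro ⟨⟨D, rfl | ⟨E, hE, rfl⟩, rfl⟩, h2⟩
    · have h1 : ({n + 1, b} : Finset ℕ).erase (n + 1) ⊆ {b} := by
        intro x
        simp only [mem_erase, mem_insert, mem_singleton]
        tauto
      have := card_le_card h1
      rw [card_singleton] at this
      omega
    · rwa [liftCluster_erase (notMem_of_subset_Icc (hG.1 E hE).1)]
  · intro hC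
    exact ⟨⟨_, Or.inr ⟨C, hC, rfl⟩, liftCluster_erase (notMem_of_subset_Icc (hG.1 C hC).1)⟩,
      (hG.1 C hC).2.1⟩

theorem contract_mono {n : ℕ} {F G : Finset (Finset ℕ)} (h : F ⊆ G) :
    contract n F ⊆ contract n G :=
  filter_subset_filter _ (image_subset_image h)

theorem lift_mono {n b : ℕ} {F G : Finset (Finset ℕ)} (h : F ⊆ G) : lift n b F ⊆ lift n b G :=
  insert_subset_insert _ (image_subset_image h)

theorem card_lift {n b : ℕ} {G : Finset (Finset ℕ)} (hG : IsWhFace n G) :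
    (lift n b G).card = G.card + 1 := by
  unfold lift
  rw [card_insert_of_notMem, card_image_of_injOn]
  · exact (liftCluster_injOn n b).mono fun C hC => notMem_of_subset_Icc (hG.1 C hC).1
  · intro h
    obtain ⟨C, hC, h⟩ := mem_image.1 h
    exact liftCluster_ne (notMem_of_subset_Icc (hG.1 C hC).1) (hG.1 C hC).2.1 h

theorem lift_erase {n b : ℕ} {G : Finset (Finset ℕ)} (hG : IsWhFace n G) {D : Finset ℕ}
    (hD : D ∈ G) : (lift n b G).erase (liftCluster n b D) = lift n b (G.erase D) := by
  have h1 := hG.1 D hD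
  have hne := liftCluster_ne (b := b) (notMem_of_subset_Icc h1.1) h1.2.1
  unfold lift
  rw [erase_insert_of_ne hne.symm]
  congr 1
  ext C
  simp only [mem_erase, mem_image]
  constructor
  · rintro ⟨h, E, hE, rfl⟩
    exact ⟨E, ⟨fun h' => h (by rw [h']), hE⟩, rfl⟩
  · rintro ⟨E, ⟨h, hE⟩, rfl⟩
    exact ⟨fun h' => h (liftCluster_injOn n b (notMem_of_subset_Icc (hG.1 E hE).1)
      (notMem_of_subset_Icc h1.1) h'), E, hE, rfl⟩

theorem isWhFace_lift {n b : ℕ} (hn : 3 ≤ n) (hb : b ∈ Icc 2 n) {G : Finset (Finset ℕ)}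
    (hG : IsWhFace n G) : IsWhFace (n + 1) (lift n b G) := by
  have hb' := mem_Icc.1 hb
  have hI : Icc 2 n ⊆ Icc 2 (n + 1) := Icc_subset_Icc_right (by omega)
  have hP (C : Finset ℕ) (hC : C ⊆ Icc 2 n) :
      {n + 1, b} ⊆ liftCluster n b C ∨ {n + 1, b} ∩ liftCluster n b C = ∅ := by
    unfold liftCluster
    split_ifs with h
    · left
      intro x
      simp only [mem_insert, mem_singleton]
      rintro (rfl | rfl)
      · simp
      · exact Or.inr h
    · right
      have h2 := notMem_of_subset_Icc hC
      rw [← disjoint_iff_inter_eq_empty]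
      simp [h2, h]
  constructor
  · intro S hS
    rcases mem_insert.1 hS with rfl | hS
    · refine ⟨?_, ?_⟩
      · intro x
        simp only [mem_insert, mem_singleton, mem_Icc]
        omega
      · rw [card_pair (by omega)]
        omega
    · obtain ⟨C, hC, rfl⟩ := mem_image.1 hS
      obtain ⟨h1, h2, h3⟩ := hG.1 C hC
      unfold liftCluster
      split_ifs
      · refine ⟨insert_subset (mem_Icc.2 (by omega)) (h1.trans hI), ?_⟩
        rw [card_insert_of_notMem (notMem_of_subset_Icc h1)]
        omega
      · exact ⟨h1.trans hI, h2, by omega⟩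
  · intro S hS T hT
    rcases mem_insert.1 hS with rfl | hS <;> rcases mem_insert.1 hT with rfl | hT
    · exact Or.inl Subset.rfl
    · obtain ⟨C, hC, rfl⟩ := mem_image.1 hT
      have := hP C (hG.1 C hC).1
      tauto
    · obtain ⟨C, hC, rfl⟩ := mem_image.1 hS
      have := hP C (hG.1 C hC).1
      rw [inter_comm] at this
      tauto
    · obtain ⟨C, hC, rfl⟩ := mem_image.1 hS
      obtain ⟨D, hD, rfl⟩ := mem_image.1 hT
      have hC' := notMem_of_subset_Icc (hG.1 C hC).1
      have hD' := notMem_of_subset_Icc (hG.1 D hD).1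
      have key {C D : Finset ℕ} (h : C ⊆ D) : liftCluster n b C ⊆ liftCluster n b D := by
        unfold liftCluster
        split_ifs with h1 h2 h2
        · exact insert_subset_insert _ h
        · exact absurd (h h1) h2
        · exact h.trans (subset_insert _ _)
        · exact h
      rcases hG.2 C hC D hD with h | h | h
      · exact Or.inl (key h)
      · exact Or.inr (Or.inl (key h))
      · right; right
        rw [← disjoint_iff_inter_eq_empty] at h ⊢
        unfold liftCluster
        split_ifs with h1 h2 h2
        · exact absurd h2 (disjoint_left.1 h h1)
        · exact disjoint_insert_left.2 ⟨hD', h⟩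
        · exact disjoint_insert_right.2 ⟨hC', h⟩
        · exact h

theorem pair_mem_lift (n b : ℕ) (G : Finset (Finset ℕ)) : {n + 1, b} ∈ lift n b G :=
  mem_insert_self _ _

theorem pair_mem_unique {n b c : ℕ} {F : Finset (Finset ℕ)} (hF : IsWhFace (n + 1) F)
    (hb : b ∈ Icc 2 n) (hc : c ∈ Icc 2 n) (hbF : {n + 1, b} ∈ F) (hcF : {n + 1, c} ∈ F) :
    b = c := by
  have hb' := mem_Icc.1 hb
  have hc' := mem_Icc.1 hc
  rcases hF.2 _ hbF _ hcF with h | h | h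
  · have : b ∈ ({n + 1, c} : Finset ℕ) := h (by simp)
    simp only [mem_insert, mem_singleton] at this
    omega
  · have : c ∈ ({n + 1, b} : Finset ℕ) := h (by simp)
    simp only [mem_insert, mem_singleton] at this
    omega
  · have : n + 1 ∈ ({n + 1, b} : Finset ℕ) ∩ {n + 1, c} := by simp
    rw [h] at this
    simp at this

theorem exists_eq_lift {n b : ℕ} {F : Finset (Finset ℕ)} (hF : IsWhFace (n + 1) F)
    (hb : b ∈ Icc 2 n) (hbF : {n + 1, b} ∈ F) :
    ∃ G, IsWhFace n G ∧ F = lift n b G := by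
  have hb' := mem_Icc.1 hb
  have hcard : ({n + 1, b} : Finset ℕ).card = 2 := card_pair (by omega)
  have hsplit (C : Finset ℕ) (hC : C ∈ F) (hne : C ≠ {n + 1, b}) :
      {n + 1, b} ⊂ C ∨ n + 1 ∉ C ∧ b ∉ C := by
    rcases hF.2 C hC _ hbF with h | h | h
    · exact absurd (eq_of_subset_of_card_le h (by rw [hcard]; exact (hF.1 C hC).2.1)) hne
    · exact Or.inl (h.ssubset_of_ne hne.symm)
    · rw [← disjoint_iff_inter_eq_empty] at h
      simp only [disjoint_insert_right, disjoint_singleton_right] at h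
      exact Or.inr h
  refine ⟨(F.erase {n + 1, b}).image (·.erase (n + 1)), ⟨?_, ?_⟩, ?_⟩
  · intro S hS
    obtain ⟨C, hC, rfl⟩ := mem_image.1 hS
    obtain ⟨hne, hC⟩ := mem_erase.1 hC
    obtain ⟨h1, h2, h3⟩ := hF.1 C hC
    refine ⟨?_, ?_⟩
    · intro x hx
      obtain ⟨hx1, hx⟩ := mem_erase.1 hx
      have := mem_Icc.1 (h1 hx)
      exact mem_Icc.2 (by omega)
    · rcases hsplit C hC hne with h | ⟨h, h'⟩
      · have := card_lt_card h
        rw [card_erase_of_mem (h.1 (by simp))]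
        omega
      · rw [erase_eq_of_notMem h]
        have h4 : C ⊆ (Icc 2 n).erase b := fun x hx => by
          have := mem_Icc.1 (h1 hx)
          have h5 : x ≠ n + 1 := fun e => h (e ▸ hx)
          exact mem_erase.2 ⟨fun e => h' (e ▸ hx), mem_Icc.2 (by omega)⟩
        have := card_le_card h4
        rw [card_erase_of_mem hb, Nat.card_Icc] at this
        omega
  · intro S hS T hT
    obtain ⟨C, hC, rfl⟩ := mem_image.1 hS
    obtain ⟨D, hD, rfl⟩ := mem_image.1 hT
    rcases hF.2 C (mem_of_mem_erase hC) D (mem_of_mem_erase hD) with h | h | h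
    · exact Or.inl (erase_subset_erase _ h)
    · exact Or.inr (Or.inl (erase_subset_erase _ h))
    · right; right
      rw [← disjoint_iff_inter_eq_empty] at h ⊢
      exact (h.mono_left (erase_subset _ _)).mono_right (erase_subset _ _)
  · unfold lift
    rw [image_image, image_congr (g := id), image_id, insert_erase hbF]
    intro C hC
    obtain ⟨hne, hC⟩ := mem_erase.1 hC
    simp only [Function.comp, liftCluster, mem_erase, id]
    rcases hsplit C hC hne with h | ⟨h, h'⟩
    · rw [if_pos ⟨by omega, h.1 (by simp)⟩, insert_erase (h.1 (by simp))]
    · rw [if_neg (fun h2 => h' h2.2), erase_eq_of_notMem h]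

/-! ### Faces without such a pair -/

/-- The smallest cluster containing the leaf `n + 1`. -/
def parent (n : ℕ) (F : Finset (Finset ℕ)) : Finset ℕ :=
  (Icc 2 (n + 1)).filter fun x => ∀ C ∈ F, n + 1 ∈ C → x ∈ C

/-- The cluster whose membership is toggled by the matching. -/
def pivot (n : ℕ) (F : Finset (Finset ℕ)) : Finset ℕ :=
  (parent n F).erase (n + 1)

/-- Insert the pivot if it is absent, delete it if it is present. -/
def toggle (n : ℕ) (F : Finset (Finset ℕ)) : Finset (Finset ℕ) :=
  if pivot n F ∈ F then F.erase (pivot n F) else insert (pivot n F) F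

theorem notMem_pivot (n : ℕ) (F : Finset (Finset ℕ)) : n + 1 ∉ pivot n F :=
  notMem_erase _ _

theorem parent_subset_Icc (n : ℕ) (F : Finset (Finset ℕ)) : parent n F ⊆ Icc 2 (n + 1) :=
  filter_subset _ _

theorem card_parent_le (n : ℕ) (F : Finset (Finset ℕ)) : (parent n F).card ≤ n := by
  have := card_le_card (parent_subset_Icc n F)
  rw [Nat.card_Icc] at this
  omega

theorem parent_subset {n : ℕ} {F : Finset (Finset ℕ)} {C : Finset ℕ} (hC : C ∈ F)
    (h : n + 1 ∈ C) : parent n F ⊆ C :=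
  fun _ hx => (mem_filter.1 hx).2 C hC h

theorem mem_parent {n : ℕ} (hn : 3 ≤ n) (F : Finset (Finset ℕ)) : n + 1 ∈ parent n F :=
  mem_filter.2 ⟨mem_Icc.2 (by omega), fun _ _ h => h⟩

theorem parent_anti {n : ℕ} {F G : Finset (Finset ℕ)} (h : F ⊆ G) : parent n G ⊆ parent n F :=
  fun _ hx => mem_filter.2 ⟨(mem_filter.1 hx).1, fun C hC => (mem_filter.1 hx).2 C (h hC)⟩

theorem parent_congr {n : ℕ} {F G : Finset (Finset ℕ)}
    (h : ∀ C, n + 1 ∈ C → (C ∈ F ↔ C ∈ G)) : parent n F = parent n G :=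
  filter_congr fun _ _ => forall_congr' fun C =>
    ⟨fun h1 h2 h3 => h1 ((h C h3).2 h2) h3, fun h1 h2 h3 => h1 ((h C h3).1 h2) h3⟩

theorem parent_mem_or_eq {n : ℕ} {F : Finset (Finset ℕ)} (hF : IsWhFace (n + 1) F) :
    parent n F ∈ F ∨ parent n F = Icc 2 (n + 1) := by
  rcases (F.filter (n + 1 ∈ ·)).eq_empty_or_nonempty with h | h
  · right
    refine filter_true_of_mem fun x _ C hC hC' => ?_
    have : C ∈ F.filter (n + 1 ∈ ·) := mem_filter.2 ⟨hC, hC'⟩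
    rw [h] at this
    simp at this
  · left
    obtain ⟨S, hS, hmin⟩ := exists_min_image _ Finset.card h
    obtain ⟨hSF, hSn⟩ := mem_filter.1 hS
    suffices parent n F = S by rwa [this]
    refine Subset.antisymm (parent_subset hSF hSn) fun x hx => ?_
    refine mem_filter.2 ⟨(hF.1 S hSF).1 hx, fun C hC hC' => ?_⟩
    rcases hF.2 S hSF C hC with h | h | h
    · exact h hx
    · rwa [eq_of_subset_of_card_le h (hmin C (mem_filter.2 ⟨hC, hC'⟩))]
    · have : n + 1 ∈ S ∩ C := mem_inter.2 ⟨hSn, hC'⟩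
      rw [h] at this
      simp at this

theorem three_le_card_parent {n : ℕ} (hn : 3 ≤ n) {F : Finset (Finset ℕ)}
    (hF : IsWhFace (n + 1) F) (h : ¬ HasCherry n F) : 3 ≤ (parent n F).card := by
  rcases parent_mem_or_eq hF with hp | hp
  · by_contra hlt
    obtain ⟨h1, h2, h3⟩ := hF.1 _ hp
    have h4 : (pivot n F).card = 1 := by
      rw [pivot, card_erase_of_mem (mem_parent hn F)]
      omega
    obtain ⟨b, hb⟩ := card_eq_one.1 h4
    have h5 : insert (n + 1) {b} = parent n F := by
      rw [← hb, pivot, insert_erase (mem_parent hn F)]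
    have hb1 : b ∈ pivot n F := by simp [hb]
    have hb2 := mem_Icc.1 (h1 (mem_of_mem_erase hb1))
    have hb3 := ne_of_mem_erase hb1
    exact h ⟨b, mem_Icc.2 (by omega), by rwa [h5]⟩
  · rw [hp, Nat.card_Icc]
    omega

theorem isWhFace_insert_pivot {n : ℕ} (hn : 3 ≤ n) {F : Finset (Finset ℕ)}
    (hF : IsWhFace (n + 1) F) (h : ¬ HasCherry n F) :
    IsWhFace (n + 1) (insert (pivot n F) F) := by
  have key (C : Finset ℕ) (hC : C ∈ F) :
      C ⊆ pivot n F ∨ pivot n F ⊆ C ∨ Disjoint C (pivot n F) := by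
    by_cases hC' : n + 1 ∈ C
    · exact Or.inr (Or.inl ((erase_subset _ _).trans (parent_subset hC hC')))
    · rcases parent_mem_or_eq hF with hp | hp
      · rcases hF.2 C hC _ hp with h | h | h
        · exact Or.inl fun x hx => mem_erase.2 ⟨fun e => hC' (e ▸ hx), h hx⟩
        · exact absurd (h (mem_parent hn F)) hC'
        · exact Or.inr (Or.inr
            ((disjoint_iff_inter_eq_empty.2 h).mono_right (erase_subset _ _)))
      · exact Or.inl fun x hx =>
          mem_erase.2 ⟨fun e => hC' (e ▸ hx), by rw [hp]; exact (hF.1 C hC).1 hx⟩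
  constructor
  · intro S hS
    rcases mem_insert.1 hS with rfl | hS
    · refine ⟨(erase_subset _ _).trans (parent_subset_Icc n F), ?_⟩
      have h1 := three_le_card_parent hn hF h
      have h2 := card_parent_le n F
      rw [pivot, card_erase_of_mem (mem_parent hn F)]
      omega
    · exact hF.1 S hS
  · intro S hS T hT
    rcases mem_insert.1 hS with rfl | hS <;> rcases mem_insert.1 hT with rfl | hT
    · exact Or.inl Subset.rfl
    · rw [← disjoint_iff_inter_eq_empty, disjoint_comm]
      have := key T hT
      tauto
    · rw [← disjoint_iff_inter_eq_empty]
      exact key S hS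
    · exact hF.2 S hS T hT

theorem isWhFace_toggle {n : ℕ} (hn : 3 ≤ n) {F : Finset (Finset ℕ)}
    (hF : IsWhFace (n + 1) F) (h : ¬ HasCherry n F) : IsWhFace (n + 1) (toggle n F) := by
  unfold toggle
  split_ifs
  · exact hF.mono (erase_subset _ _)
  · exact isWhFace_insert_pivot hn hF h

theorem mem_toggle_iff {n : ℕ} {F : Finset (Finset ℕ)} {C : Finset ℕ} (hC : n + 1 ∈ C) :
    C ∈ toggle n F ↔ C ∈ F := by
  have hne : C ≠ pivot n F := fun e => notMem_pivot n F (e ▸ hC)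
  unfold toggle
  split_ifs <;> simp [hne]

theorem hasCherry_toggle {n : ℕ} {F : Finset (Finset ℕ)} :
    HasCherry n (toggle n F) ↔ HasCherry n F := by
  simp [HasCherry, mem_toggle_iff]

theorem pivot_toggle (n : ℕ) (F : Finset (Finset ℕ)) : pivot n (toggle n F) = pivot n F := by
  rw [pivot, parent_congr fun _ => mem_toggle_iff, pivot]

theorem toggle_toggle (n : ℕ) (F : Finset (Finset ℕ)) : toggle n (toggle n F) = F := by
  rw [toggle, pivot_toggle]
  unfold toggle
  split_ifs with h <;> simp_all

theorem toggle_ne (n : ℕ) (F : Finset (Finset ℕ)) : toggle n F ≠ F := by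
  unfold toggle
  split_ifs with h
  · exact fun e => (e ▸ notMem_erase (pivot n F) F) h
  · exact fun e => h (insert_eq_self.1 e)

/-- A rank decreasing along the directed edges between faces without a pair `{n + 1, b}`. -/
def toggleRank (n : ℕ) (F : Finset (Finset ℕ)) : ℕ :=
  (2 * 2 ^ n + 2) * (n - (parent n F).card) +
    (2 * (F.erase (pivot n F)).card + if pivot n F ∈ F then 0 else 1)

theorem toggleRank_tail_lt {n : ℕ} {F : Finset (Finset ℕ)} (hF : IsWhFace (n + 1) F)
    (P : Finset ℕ) : 2 * (F.erase P).card + (if P ∈ F then 0 else 1) < 2 * 2 ^ n + 2 := by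
  have h1 := card_le_card ((erase_subset P F).trans hF.subset_powerset)
  rw [card_powerset, Nat.card_Icc, show n + 1 + 1 - 2 = n by omega] at h1
  split_ifs <;> omega

theorem toggleRank_lt {n : ℕ} {F : Finset (Finset ℕ)} (hF : IsWhFace (n + 1) F) :
    toggleRank n F < (2 * 2 ^ n + 2) * (n + 1) := by
  have h1 := toggleRank_tail_lt hF (pivot n F)
  have h2 : (2 * 2 ^ n + 2) * (n - (parent n F).card) ≤ (2 * 2 ^ n + 2) * n :=
    Nat.mul_le_mul_left _ (Nat.sub_le _ _)
  rw [mul_add_one]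
  exact add_lt_add_of_le_of_lt h2 h1

theorem toggleRank_erase_lt {n : ℕ} {F : Finset (Finset ℕ)} (hF : IsWhFace (n + 1) F)
    {C : Finset ℕ} (hC : C ∈ F) (hne : toggle n F ≠ F.erase C) :
    toggleRank n (F.erase C) < toggleRank n F := by
  have hCP : C ≠ pivot n F := by
    rintro rfl
    exact hne (if_pos hC)
  by_cases hp : parent n (F.erase C) = parent n F
  · have hpiv : pivot n (F.erase C) = pivot n F := by rw [pivot, hp, pivot]
    have h1 : (F.erase C).erase (pivot n F) = (F.erase (pivot n F)).erase C := erase_right_comm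
    have h2 : C ∈ F.erase (pivot n F) := mem_erase.2 ⟨hCP, hC⟩
    have h3 := card_erase_lt_of_mem h2
    have h4 : pivot n F ∈ F.erase C ↔ pivot n F ∈ F := by simp [hCP.symm]
    unfold toggleRank
    simp only [hp, hpiv, h1, h4]
    omega
  · have h1 : (parent n F).card < (parent n (F.erase C)).card :=
      card_lt_card ((parent_anti (erase_subset C F)).ssubset_of_ne (Ne.symm hp))
    have h2 := card_parent_le n (F.erase C)
    have h3 := toggleRank_tail_lt (hF.mono (erase_subset C F)) (pivot n (F.erase C))
    have h4 : (2 * 2 ^ n + 2) * (n - (parent n (F.erase C)).card + 1) ≤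
        (2 * 2 ^ n + 2) * (n - (parent n F).card) := Nat.mul_le_mul_left _ (by omega)
    rw [mul_add_one] at h4
    unfold toggleRank
    omega

theorem toggleRank_toggle_lt {n : ℕ} {F : Finset (Finset ℕ)} (h : F ⊆ toggle n F) :
    toggleRank n (toggle n F) < toggleRank n F := by
  have hP : pivot n F ∉ F := fun hP => by
    have := h hP
    rw [toggle, if_pos hP] at this
    exact notMem_erase _ _ this
  have h1 : parent n (toggle n F) = parent n F := parent_congr fun _ => mem_toggle_iff
  have h2 : toggle n F = insert (pivot n F) F := if_neg hP
  unfold toggleRank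
  rw [pivot_toggle, h1, h2]
  simp [hP]

/-! ### The matching, by induction on `n` -/

/-- `μ` is an involution on the faces of `Δ_n` whose non-trivial orbits are cover relations and
which, as witnessed by the rank function `r`, is an acyclic matching. -/
structure IsMorseInvolution (n : ℕ) (μ : Finset (Finset ℕ) → Finset (Finset ℕ))
    (r : Finset (Finset ℕ) → ℕ) : Prop where
  isWhFace : ∀ F, IsWhFace n F → IsWhFace n (μ F)
  involutive : ∀ F, IsWhFace n F → μ (μ F) = F
  cover : ∀ F, IsWhFace n F →
    F ⊆ μ F ∧ (μ F).card ≤ F.card + 1 ∨ μ F ⊆ F ∧ F.card ≤ (μ F).card + 1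
  rank_erase : ∀ F, IsWhFace n F → ∀ C ∈ F, μ F ≠ F.erase C → r (F.erase C) < r F
  rank_up : ∀ F, IsWhFace n F → F ⊆ μ F → μ F ≠ F → r (μ F) < r F

open Classical in
/-- Extend an involution from the faces of `Δ_n` to those of `Δ_{n+1}`. -/
noncomputable def extend (n : ℕ) (μ : Finset (Finset ℕ) → Finset (Finset ℕ))
    (F : Finset (Finset ℕ)) : Finset (Finset ℕ) :=
  if h : HasCherry n F then lift n h.choose (μ (contract n F)) else toggle n F

open Classical in
/-- Extend a rank function from the faces of `Δ_n` to those of `Δ_{n+1}`. -/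
noncomputable def extendRank (n : ℕ) (r : Finset (Finset ℕ) → ℕ) (F : Finset (Finset ℕ)) : ℕ :=
  if HasCherry n F then (2 * 2 ^ n + 2) * (n + 1) + r (contract n F) else toggleRank n F

theorem hasCherry_lift {n b : ℕ} (hb : b ∈ Icc 2 n) (G : Finset (Finset ℕ)) :
    HasCherry n (lift n b G) :=
  ⟨b, hb, pair_mem_lift n b G⟩

theorem extend_lift {n b : ℕ} (hn : 3 ≤ n) (hb : b ∈ Icc 2 n) {G : Finset (Finset ℕ)}
    (hG : IsWhFace n G) (μ : Finset (Finset ℕ) → Finset (Finset ℕ)) :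
    extend n μ (lift n b G) = lift n b (μ G) := by
  have h := hasCherry_lift hb G
  rw [extend, dif_pos h, contract_lift hG, pair_mem_unique (isWhFace_lift hn hb hG)
    h.choose_spec.1 hb h.choose_spec.2 (pair_mem_lift n b G)]

theorem extendRank_lift {n b : ℕ} (hb : b ∈ Icc 2 n) {G : Finset (Finset ℕ)}
    (hG : IsWhFace n G) (r : Finset (Finset ℕ) → ℕ) :
    extendRank n r (lift n b G) = (2 * 2 ^ n + 2) * (n + 1) + r G := by
  rw [extendRank, if_pos (hasCherry_lift hb G), contract_lift hG]

theorem not_hasCherry_or_eq_lift {n : ℕ} {F : Finset (Finset ℕ)} (hF : IsWhFace (n + 1) F) :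
    ¬ HasCherry n F ∨ ∃ b ∈ Icc 2 n, ∃ G, IsWhFace n G ∧ F = lift n b G := by
  by_cases h : HasCherry n F
  · obtain ⟨b, hb, hbF⟩ := h
    exact Or.inr ⟨b, hb, exists_eq_lift hF hb hbF⟩
  · exact Or.inl h

theorem IsMorseInvolution.extend {n : ℕ} (hn : 3 ≤ n)
    {μ : Finset (Finset ℕ) → Finset (Finset ℕ)} {r : Finset (Finset ℕ) → ℕ}
    (H : IsMorseInvolution n μ r) :
    IsMorseInvolution (n + 1) (extend n μ) (extendRank n r) where
  isWhFace F hF := by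
    obtain h | ⟨b, hb, G, hG, rfl⟩ := not_hasCherry_or_eq_lift hF
    · rw [Whitehouse.extend, dif_neg h]
      exact isWhFace_toggle hn hF h
    · rw [extend_lift hn hb hG]
      exact isWhFace_lift hn hb (H.isWhFace G hG)
  involutive F hF := by
    obtain h | ⟨b, hb, G, hG, rfl⟩ := not_hasCherry_or_eq_lift hF
    · rw [Whitehouse.extend.eq_def n μ F, dif_neg h, Whitehouse.extend,
        dif_neg (hasCherry_toggle.not.2 h), toggle_toggle]
    · rw [extend_lift hn hb hG, extend_lift hn hb (H.isWhFace G hG), H.involutive G hG]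
  cover F hF := by
    obtain h | ⟨b, hb, G, hG, rfl⟩ := not_hasCherry_or_eq_lift hF
    · rw [Whitehouse.extend, dif_neg h, toggle]
      split_ifs with hP
      · exact Or.inr ⟨erase_subset _ _, (card_erase_add_one hP).ge⟩
      · exact Or.inl ⟨subset_insert _ _, card_insert_le _ _⟩
    · rw [extend_lift hn hb hG, card_lift hG, card_lift (H.isWhFace G hG)]
      exact (H.cover G hG).imp (fun h => ⟨lift_mono h.1, by omega⟩)
        (fun h => ⟨lift_mono h.1, by omega⟩)
  rank_erase F hF C hC hne := by
    obtain h | ⟨b, hb, G, hG, rfl⟩ := not_hasCherry_or_eq_lift hF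
    · have h' : ¬ HasCherry n (F.erase C) := fun ⟨b, hb, hbF⟩ => h ⟨b, hb, mem_of_mem_erase hbF⟩
      rw [Whitehouse.extend, dif_neg h] at hne
      rw [extendRank, extendRank, if_neg h, if_neg h']
      exact toggleRank_erase_lt hF hC hne
    · rw [extendRank_lift hb hG]
      rcases mem_insert.1 hC with rfl | hC
      · have h' : ¬ HasCherry n ((lift n b G).erase {n + 1, b}) := by
          rintro ⟨c, hc, hcF⟩
          obtain ⟨h1, h2⟩ := mem_erase.1 hcF
          exact h1 (by rw [pair_mem_unique hF hb hc (pair_mem_lift n b G) h2])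
        rw [extendRank, if_neg h']
        exact (toggleRank_lt (hF.mono (erase_subset _ _))).trans_le (Nat.le_add_right _ _)
      · obtain ⟨D, hD, rfl⟩ := mem_image.1 hC
        rw [extend_lift hn hb hG, lift_erase hG hD] at hne
        rw [lift_erase hG hD, extendRank_lift hb (hG.mono (erase_subset _ _))]
        exact Nat.add_lt_add_left (H.rank_erase G hG D hD fun e => hne (by rw [e])) _
  rank_up F hF hsub hne := by
    obtain h | ⟨b, hb, G, hG, rfl⟩ := not_hasCherry_or_eq_lift hF
    · rw [Whitehouse.extend, dif_neg h] at hsub ⊢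
      rw [extendRank, extendRank, if_neg h, if_neg (hasCherry_toggle.not.2 h)]
      exact toggleRank_toggle_lt hsub
    · rw [extend_lift hn hb hG] at hsub hne ⊢
      have hG' := H.isWhFace G hG
      rw [extendRank_lift hb hG, extendRank_lift hb hG']
      have hsub' := contract_mono (n := n) hsub
      rw [contract_lift hG, contract_lift hG'] at hsub'
      exact Nat.add_lt_add_left (H.rank_up G hG hsub' fun e => hne (by rw [e])) _

theorem setOf_extend_eq_self {n : ℕ} (hn : 3 ≤ n)
    {μ : Finset (Finset ℕ) → Finset (Finset ℕ)} (hμ : ∀ F, IsWhFace n F → IsWhFace n (μ F)) :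
    {F | IsWhFace (n + 1) F ∧ extend n μ F = F} =
      (fun p : ℕ × Finset (Finset ℕ) => lift n p.1 p.2) ''
        ((Icc 2 n : Finset ℕ) ×ˢ {G | IsWhFace n G ∧ μ G = G}) := by
  ext F
  constructor
  · rintro ⟨hF, hcrit⟩
    obtain h | ⟨b, hb, G, hG, rfl⟩ := not_hasCherry_or_eq_lift hF
    · rw [extend, dif_neg h] at hcrit
      exact absurd hcrit (toggle_ne n F)
    · rw [extend_lift hn hb hG] at hcrit
      refine ⟨(b, G), ⟨hb, hG, ?_⟩, rfl⟩
      rw [← contract_lift (b := b) (hμ G hG), hcrit, contract_lift hG]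
  · rintro ⟨⟨b, G⟩, ⟨hb, hG, hcrit⟩, rfl⟩
    exact ⟨isWhFace_lift hn hb hG, by rw [extend_lift hn hb hG, hcrit]⟩

theorem lift_injOn {n : ℕ} (hn : 3 ≤ n) :
    Set.InjOn (fun p : ℕ × Finset (Finset ℕ) => lift n p.1 p.2)
      ((Icc 2 n : Finset ℕ) ×ˢ {G | IsWhFace n G}) := by
  rintro ⟨b, G⟩ ⟨hb, hG⟩ ⟨c, G'⟩ ⟨hc, hG'⟩ (h : lift n b G = lift n c G')
  dsimp only at hb hG hc hG'
  have hbc : b = c := pair_mem_unique (isWhFace_lift hn hb hG) hb hc (pair_mem_lift n b G)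
    (h ▸ pair_mem_lift n c G')
  rw [Prod.mk.injEq]
  exact ⟨hbc, (contract_lift hG).symm.trans (h ▸ contract_lift hG')⟩

theorem isWhFace_three_iff {F : Finset (Finset ℕ)} : IsWhFace 3 F ↔ F = ∅ := by
  constructor
  · intro hF
    refine eq_empty_of_forall_notMem fun S hS => ?_
    have := hF.1 S hS
    omega
  · rintro rfl
    simp [IsWhFace]

theorem exists_isMorseInvolution (n : ℕ) (hn : 3 ≤ n) :
    ∃ μ r, IsMorseInvolution n μ r ∧
      {F | IsWhFace n F ∧ μ F = F}.ncard = (n - 2).factorial ∧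
      ∀ F, IsWhFace n F → μ F = F → F.card = n - 3 := by
  induction n, hn using Nat.le_induction with
  | base =>
    refine ⟨id, fun _ => 0, ?_, ?_, ?_⟩
    · constructor <;> simp [isWhFace_three_iff]
    · simp [isWhFace_three_iff]
    · simp [isWhFace_three_iff]
  | succ n hn ih =>
    obtain ⟨μ, r, H, hcount, hcard⟩ := ih
    refine ⟨extend n μ, extendRank n r, H.extend hn, ?_, ?_⟩
    · rw [setOf_extend_eq_self hn H.isWhFace, ((lift_injOn hn).mono
        (Set.prod_mono_right fun _ h => h.1)).ncard_image, Set.ncard_prod, hcount,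
        Set.ncard_coe_finset, Nat.card_Icc, show n + 1 - 2 = n - 2 + 1 by omega,
        Nat.factorial_succ]
    · intro F hF hcrit
      have h : F ∈ {F | IsWhFace (n + 1) F ∧ extend n μ F = F} := ⟨hF, hcrit⟩
      rw [setOf_extend_eq_self hn H.isWhFace] at h
      obtain ⟨⟨b, G⟩, ⟨-, hG, hGcrit⟩, rfl⟩ := h
      dsimp only at hG hGcrit ⊢
      rw [card_lift hG, hcard G hG hGcrit]
      omega

end Whitehouse

/-- There is a Morse matching on the face poset of the Whitehouse complex `Δ_n`
(faces ordered by inclusion, including the empty face; a cover relation `F ⋖ G` means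
`F ⊆ G` and `|G| = |F| + 1`) whose critical (unmatched) faces number exactly `(n-2)!`
and all have exactly `n-3` elements, i.e. are facets of dimension `n-4`. -/
theorem stmt12 (n : ℕ) (hn : 3 ≤ n) :
    ∃ M : Finset (Finset (Finset ℕ) × Finset (Finset ℕ)),
      -- every pair of `M` is a cover relation of the face poset of `Δ_n`
      (∀ p ∈ M, IsWhFace n p.1 ∧ IsWhFace n p.2 ∧ p.1 ⊆ p.2 ∧
        p.2.card = p.1.card + 1) ∧
      -- `M` is a matching: its pairs are pairwise disjoint
      (∀ p ∈ M, ∀ q ∈ M, p ≠ q →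
        p.1 ≠ q.1 ∧ p.1 ≠ q.2 ∧ p.2 ≠ q.1 ∧ p.2 ≠ q.2) ∧
      -- `M` is a Morse matching: orienting cover edges downwards and the edges of `M`
      -- upwards yields an acyclic directed graph
      (¬ ∃ x : Finset (Finset ℕ), Relation.TransGen
        (fun x y => IsWhFace n x ∧ IsWhFace n y ∧
          ((y ⊆ x ∧ x.card = y.card + 1 ∧ (y, x) ∉ M) ∨
           (x ⊆ y ∧ y.card = x.card + 1 ∧ (x, y) ∈ M))) x x) ∧
      -- there are exactly `(n-2)!` critical faces
      Set.ncard {F : Finset (Finset ℕ) | IsWhFace n F ∧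
        ∀ p ∈ M, F ≠ p.1 ∧ F ≠ p.2} = Nat.factorial (n - 2) ∧
      -- and every critical face has exactly `n-3` elements
      (∀ F : Finset (Finset ℕ), IsWhFace n F → (∀ p ∈ M, F ≠ p.1 ∧ F ≠ p.2) →
        F.card = n - 3) := by
  obtain ⟨μ, r, H, hcount, hcard⟩ := Whitehouse.exists_isMorseInvolution n hn
  classical
  let A : Finset (Finset (Finset ℕ)) := (Whitehouse.finite_setOf_isWhFace n).toFinset
  have hA (F) : F ∈ A ↔ IsWhFace n F := by simp [A]
  let M := (A ×ˢ A).filter fun p => p.2 = μ p.1 ∧ p.1 ⊂ p.2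
  have hM (x y) : (x, y) ∈ M ↔ IsWhFace n x ∧ y = μ x ∧ x ⊂ y := by
    simp only [M, mem_filter, mem_product, hA]
    exact ⟨fun h => ⟨h.1.1, h.2⟩, fun h => ⟨⟨h.1, h.2.1 ▸ H.isWhFace x h.1⟩, h.2⟩⟩
  have hback {x y} (h : (x, y) ∈ M) : x = μ y := by
    obtain ⟨h1, rfl, -⟩ := (hM x y).1 h
    exact (H.involutive x h1).symm
  have hcrit (F) (hF : IsWhFace n F) : (∀ p ∈ M, F ≠ p.1 ∧ F ≠ p.2) ↔ μ F = F := by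
    constructor
    · intro h
      by_contra hne
      rcases H.cover F hF with ⟨hs, -⟩ | ⟨hs, -⟩
      · exact (h (F, μ F) ((hM _ _).2 ⟨hF, rfl, hs.ssubset_of_ne (Ne.symm hne)⟩)).1 rfl
      · exact (h (μ F, F) ((hM _ _).2 ⟨H.isWhFace F hF, (H.involutive F hF).symm,
          hs.ssubset_of_ne hne⟩)).2 rfl
    · rintro h ⟨x, y⟩ hp
      have hxy := ((hM x y).1 hp).2
      have hyx := hback hp
      refine ⟨?_, ?_⟩ <;> rintro rfl
      · exact hxy.2.ne (hxy.1.trans h).symm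
      · exact hxy.2.ne (hyx.trans h)
  refine ⟨M, ?_, ?_, ?_, ?_, fun F hF h => hcard F hF ((hcrit F hF).1 h)⟩
  · rintro ⟨x, y⟩ hp
    obtain ⟨h1, rfl, h3⟩ := (hM x y).1 hp
    refine ⟨h1, H.isWhFace x h1, h3.1, ?_⟩
    have h4 := card_lt_card h3
    rcases H.cover x h1 with h | h
    · exact le_antisymm h.2 h4
    · exact absurd h.1 h3.2
  · rintro ⟨x, y⟩ hp ⟨z, w⟩ hq hne
    have hp1 := ((hM x y).1 hp).2
    have hq1 := ((hM z w).1 hq).2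
    have hp2 := hback hp
    have hq2 := hback hq
    refine ⟨?_, ?_, ?_, ?_⟩ <;> intro e <;> dsimp only at e <;> subst e
    · exact hne (by rw [hp1.1, hq1.1])
    · rw [← hq2] at hp1
      exact hp1.2.asymm (hp1.1 ▸ hq1.2)
    · rw [← hp2] at hq1
      exact hq1.2.asymm (hq1.1 ▸ hp1.2)
    · exact hne (by rw [hp2, hq2])
  · rintro ⟨x, hx⟩
    have hdec : ∀ {x y}, Relation.TransGen
        (fun x y => IsWhFace n x ∧ IsWhFace n y ∧
          ((y ⊆ x ∧ x.card = y.card + 1 ∧ (y, x) ∉ M) ∨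
           (x ⊆ y ∧ y.card = x.card + 1 ∧ (x, y) ∈ M))) x y → r y < r x := by
      have hstep {x y} (h : IsWhFace n x ∧ IsWhFace n y ∧
          ((y ⊆ x ∧ x.card = y.card + 1 ∧ (y, x) ∉ M) ∨
           (x ⊆ y ∧ y.card = x.card + 1 ∧ (x, y) ∈ M))) : r y < r x := by
        obtain ⟨hx, hy, ⟨hs, hc, hnM⟩ | ⟨hs, -, hmem⟩⟩ := h
        · have hss : y ⊂ x := hs.ssubset_of_ne (by rintro rfl; omega)
          obtain ⟨C, hCx, hCy⟩ := exists_of_ssubset hss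
          have hxy : y = x.erase C := eq_of_subset_of_card_le (subset_erase.2 ⟨hs, hCy⟩)
            (by rw [card_erase_of_mem hCx]; omega)
          have hne : μ x ≠ x.erase C := fun e =>
            hnM ((hM y x).2 ⟨hy, by rw [hxy, ← e, H.involutive x hx], hss⟩)
          rw [hxy]
          exact H.rank_erase x hx C hCx hne
        · obtain ⟨-, rfl, hss⟩ := (hM x y).1 hmem
          exact H.rank_up x hx hs hss.ne'
      intro x y h
      induction h with
      | single h => exact hstep h
      | tail _ h ih => exact (hstep h).trans ih
    exact (hdec hx).false
  · rw [← hcount]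
    congr 1
    ext F
    exact and_congr_right (hcrit F)
end

section
/- For every integer n ≥ 3, the alternating sum over all faces F of the Whitehouse complex Δ_n (including the empty face) of (−1)^{|F|} equals (−1)^{n−3}·(n−2)!. Equivalently, the reduced Euler characteristic of Δ_n is (−1)^{n−4}·(n−2)!. -/
open scoped Classical in
/-- The (finite) set of all faces of the Whitehouse complex `Δ_n`. -/
noncomputable def whFaces (n : ℕ) : Finset (Finset (Finset ℕ)) :=
  ((Finset.Icc 2 n).powerset.powerset).filter (IsWhFace n)

/-- `F` is a laminar family of subsets of `A`, each with at least two elements, and `A ∈ F`. -/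
def IsRootedLaminar {α : Type*} [DecidableEq α] (A : Finset α) (F : Finset (Finset α)) : Prop :=
  (∀ S ∈ F, S ⊆ A ∧ 2 ≤ S.card) ∧
  (∀ S ∈ F, ∀ T ∈ F, S ⊆ T ∨ T ⊆ S ∨ S ∩ T = ∅) ∧ A ∈ F

open scoped Classical in
/-- The finite set of all rooted laminar families on `A`. -/
noncomputable def rootedLaminar {α : Type*} [DecidableEq α] (A : Finset α) :
    Finset (Finset (Finset α)) :=
  A.powerset.powerset.filter (IsRootedLaminar A)

section RootedLaminar

variable {α : Type*} [DecidableEq α]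

theorem mem_rootedLaminar {A : Finset α} {F : Finset (Finset α)} :
    F ∈ rootedLaminar A ↔ IsRootedLaminar A F := by
  simp only [rootedLaminar, Finset.mem_filter, Finset.mem_powerset, and_iff_right_iff_imp]
  exact fun h S hS => Finset.mem_powerset.2 (h.1 S hS).1

/-- The intersection with `A` of all members of `F` that contain `x`. -/
def hull (A : Finset α) (x : α) (F : Finset (Finset α)) : Finset α :=
  A.filter fun y => ∀ S ∈ F, x ∈ S → y ∈ S

/-- Add `v` to `F` if it is absent, remove it otherwise. -/
def toggle (v : Finset α) (F : Finset (Finset α)) : Finset (Finset α) :=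
  if v ∈ F then F.erase v else insert v F

theorem mem_toggle_of_ne {v S : Finset α} {F : Finset (Finset α)} (h : S ≠ v) :
    S ∈ toggle v F ↔ S ∈ F := by
  unfold toggle; split_ifs <;> simp [h]

theorem toggle_toggle (v : Finset α) (F : Finset (Finset α)) : toggle v (toggle v F) = F := by
  by_cases h : v ∈ F <;> simp [toggle, h]

theorem neg_one_pow_card_toggle (v : Finset α) (F : Finset (Finset α)) :
    (-1 : ℤ) ^ F.card + (-1) ^ (toggle v F).card = 0 := by
  by_cases h : v ∈ F
  · rw [toggle, if_pos h, ← Finset.card_erase_add_one h]; ring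
  · rw [toggle, if_neg h, Finset.card_insert_of_notMem h]; ring

theorem toggle_ne (v : Finset α) (F : Finset (Finset α)) : toggle v F ≠ F := by
  intro h
  have := neg_one_pow_card_toggle v F
  rw [h] at this
  have h2 : (-1 : ℤ) ^ F.card ≠ 0 := by simp
  omega

theorem hull_toggle {A v : Finset α} {x : α} {F : Finset (Finset α)} (hv : x ∉ v) :
    hull A x (toggle v F) = hull A x F := by
  unfold hull
  refine Finset.filter_congr fun y _ => forall_congr' fun S => ?_
  by_cases h : S = v
  · subst h; simp [hv]
  · rw [mem_toggle_of_ne h]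

theorem IsRootedLaminar.hull_mem {A : Finset α} {F : Finset (Finset α)} {x : α}
    (hF : IsRootedLaminar A F) (hx : x ∈ A) : hull A x F ∈ F := by
  obtain ⟨P, hP, hmin⟩ := Finset.exists_min_image (F.filter (x ∈ ·)) Finset.card
    ⟨A, by simp [hF.2.2, hx]⟩
  simp only [Finset.mem_filter] at hP hmin
  have key : ∀ S ∈ F, x ∈ S → P ⊆ S := by
    intro S hS hxS
    rcases hF.2.1 P hP.1 S hS with h | h | h
    · exact h
    · exact (Finset.eq_of_subset_of_card_le h (hmin S ⟨hS, hxS⟩)).ge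
    · have : x ∈ P ∩ S := Finset.mem_inter.2 ⟨hP.2, hxS⟩
      simp [h] at this
  have : hull A x F = P := by
    ext y
    simp only [hull, Finset.mem_filter]
    exact ⟨fun h => h.2 P hP.1 hP.2, fun h => ⟨(hF.1 P hP.1).1 h, fun S hS hxS => key S hS hxS h⟩⟩
  rw [this]; exact hP.1

theorem mem_hull_self {A : Finset α} {F : Finset (Finset α)} {x : α} (hx : x ∈ A) :
    x ∈ hull A x F := by
  simp [hull, hx]

theorem hull_subset {A S : Finset α} {F : Finset (Finset α)} {x : α} (hS : S ∈ F) (hx : x ∈ S) :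
    hull A x F ⊆ S :=
  fun _ hy => (Finset.mem_filter.1 hy).2 S hS hx

theorem IsRootedLaminar.toggle_hull {A : Finset α} {F : Finset (Finset α)} {x : α}
    (hF : IsRootedLaminar A F) (hx : x ∈ A) (hcard : (hull A x F).card ≠ 2) :
    IsRootedLaminar A (toggle ((hull A x F).erase x) F) := by
  set P := hull A x F with hPdef
  have hP : P ∈ F := hF.hull_mem hx
  have hxP : x ∈ P := mem_hull_self hx
  have hv : ∀ S ∈ F, S ⊆ P.erase x ∨ P.erase x ⊆ S ∨ S ∩ P.erase x = ∅ := by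
    intro S hS
    by_cases hxS : x ∈ S
    · exact Or.inr (Or.inl ((Finset.erase_subset _ _).trans (hull_subset hS hxS)))
    · rcases hF.2.1 S hS P hP with h | h | h
      · exact Or.inl (Finset.subset_erase.2 ⟨h, hxS⟩)
      · exact absurd (h hxP) hxS
      · refine Or.inr (Or.inr (Finset.subset_empty.1 ?_))
        rw [← h]
        exact Finset.inter_subset_inter_left (Finset.erase_subset _ _)
  have hmem : ∀ S ∈ toggle (P.erase x) F, S = P.erase x ∨ S ∈ F := by
    intro S hS
    by_cases h : S = P.erase x
    · exact Or.inl h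
    · exact Or.inr ((mem_toggle_of_ne h).1 hS)
  refine ⟨?_, ?_, ?_⟩
  · intro S hS
    rcases hmem S hS with rfl | h
    · refine ⟨(Finset.erase_subset _ _).trans (hF.1 P hP).1, ?_⟩
      have := (hF.1 P hP).2
      rw [Finset.card_erase_of_mem hxP]
      omega
    · exact hF.1 S h
  · intro S hS T hT
    rcases hmem S hS with rfl | h <;> rcases hmem T hT with rfl | h'
    · exact Or.inl subset_rfl
    · rcases hv T h' with h | h | h
      · exact Or.inr (Or.inl h)
      · exact Or.inl h
      · exact Or.inr (Or.inr (by rw [Finset.inter_comm]; exact h))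
    · exact hv S h
    · exact hF.2.1 S h T h'
  · rw [mem_toggle_of_ne]
    · exact hF.2.2
    · intro h
      rw [h] at hx
      simp at hx

theorem sum_rootedLaminar_card_hull_ne_two {A : Finset α} {x : α} (hx : x ∈ A) :
    ∑ F ∈ (rootedLaminar A).filter (fun F => (hull A x F).card ≠ 2), (-1 : ℤ) ^ F.card = 0 := by
  refine Finset.sum_involution (fun F _ => toggle ((hull A x F).erase x) F) ?_ ?_ ?_ ?_
  · exact fun F _ => neg_one_pow_card_toggle _ _
  · exact fun F _ _ => toggle_ne _ _
  · intro F hF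
    rw [Finset.mem_filter, mem_rootedLaminar] at hF ⊢
    refine ⟨hF.1.toggle_hull hx hF.2, ?_⟩
    rw [hull_toggle (Finset.notMem_erase _ _)]
    exact hF.2
  · intro F _
    simp only [hull_toggle (Finset.notMem_erase _ _), toggle_toggle]

theorem IsRootedLaminar.card_hull_eq_two_iff {A : Finset α} {F : Finset (Finset α)} {x : α}
    (hF : IsRootedLaminar A F) (hx : x ∈ A) :
    (hull A x F).card = 2 ↔ ∃ a ∈ A.erase x, {x, a} ∈ F := by
  have hP := hF.hull_mem hx
  constructor
  · intro h
    obtain ⟨a, ha⟩ : ∃ a, (hull A x F).erase x = {a} := by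
      rw [← Finset.card_eq_one, Finset.card_erase_of_mem (mem_hull_self hx), h]
    have hPa : hull A x F = {x, a} := by
      rw [← Finset.insert_erase (mem_hull_self (F := F) hx), ha]
    have haP : a ∈ (hull A x F).erase x := by simp [ha]
    exact ⟨a, Finset.erase_subset_erase x (hF.1 _ hP).1 haP, hPa ▸ hP⟩
  · rintro ⟨a, -, h⟩
    have h1 := Finset.card_le_card (hull_subset (A := A) h (Finset.mem_insert_self x {a}))
    exact le_antisymm (h1.trans Finset.card_le_two) (hF.1 _ hP).2

theorem eq_of_pair_laminar {F : Finset (Finset α)} {x a : α} {S : Finset α}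
    (hlam : ∀ S ∈ F, ∀ T ∈ F, S ⊆ T ∨ T ⊆ S ∨ S ∩ T = ∅) (hp : {x, a} ∈ F) (hS : S ∈ F)
    (hcard : 2 ≤ S.card) (hne : S ≠ {x, a}) :
    {x, a} ⊆ S ∨ x ∉ S ∧ a ∉ S := by
  rcases hlam S hS _ hp with h | h | h
  · exact absurd (Finset.eq_of_subset_of_card_le h (Finset.card_le_two.trans hcard)) hne
  · exact Or.inl h
  · refine Or.inr ⟨fun hx => ?_, fun ha => ?_⟩
    · have : x ∈ S ∩ {x, a} := by simp [hx]
      simp [h] at this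
    · have : a ∈ S ∩ {x, a} := by simp [ha]
      simp [h] at this

/-- Adjoin `x` to those sets which contain `a`. -/
def adjoinTwin (x a : α) (S : Finset α) : Finset α :=
  if a ∈ S then insert x S else S

theorem adjoinTwin_erase {x a : α} {S : Finset α} (hxa : a ≠ x)
    (h : {x, a} ⊆ S ∨ x ∉ S ∧ a ∉ S) : adjoinTwin x a (S.erase x) = S := by
  rcases h with h | ⟨h, h'⟩
  · have hx : x ∈ S := h (by simp)
    have ha : a ∈ S := h (by simp)
    simp [adjoinTwin, hxa, ha, hx]
  · simp [adjoinTwin, h, h']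

theorem erase_adjoinTwin {x a : α} {S : Finset α} (hx : x ∉ S) :
    (adjoinTwin x a S).erase x = S := by
  unfold adjoinTwin; split_ifs <;> simp [hx]

theorem adjoinTwin_ne_pair {x a : α} {S : Finset α} (hx : x ∉ S) (hcard : 2 ≤ S.card) :
    adjoinTwin x a S ≠ {x, a} := by
  intro h
  have h1 := erase_adjoinTwin (a := a) hx
  rw [h] at h1
  have h2 : S ⊆ {a} := by
    rw [← h1]; intro y; simp only [Finset.mem_erase, Finset.mem_insert, Finset.mem_singleton]; tauto
  have := Finset.card_le_card h2
  simp at this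
  omega

theorem adjoinTwin_laminar {x a : α} {S T : Finset α} (hxS : x ∉ S) (hxT : x ∉ T)
    (h : S ⊆ T ∨ T ⊆ S ∨ S ∩ T = ∅) :
    adjoinTwin x a S ⊆ adjoinTwin x a T ∨ adjoinTwin x a T ⊆ adjoinTwin x a S ∨
      adjoinTwin x a S ∩ adjoinTwin x a T = ∅ := by
  have mono : ∀ {S T : Finset α}, S ⊆ T → adjoinTwin x a S ⊆ adjoinTwin x a T := by
    intro S T h y hy
    unfold adjoinTwin at *
    split_ifs at * <;> grind
  rcases h with h | h | h
  · exact Or.inl (mono h)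
  · exact Or.inr (Or.inl (mono h))
  · refine Or.inr (Or.inr ?_)
    ext y
    have hy : ∀ y, ¬ (y ∈ S ∧ y ∈ T) := fun y hy => by
      have := Finset.mem_inter.2 hy
      simp [h] at this
    have h1 := hy a
    have h2 := hy y
    unfold adjoinTwin
    split_ifs <;> grind

theorem IsRootedLaminar.image_erase {A : Finset α} {x a : α} {F : Finset (Finset α)}
    (hx : x ∉ A) (hA : 2 ≤ A.card) (hF : IsRootedLaminar (insert x A) F) (hp : {x, a} ∈ F) :
    IsRootedLaminar A ((F.erase {x, a}).image (·.erase x)) := by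
  refine ⟨?_, ?_, ?_⟩
  · simp only [Finset.mem_image, Finset.mem_erase]
    rintro _ ⟨S, ⟨hne, hS⟩, rfl⟩
    have hS' := hF.1 S hS
    refine ⟨fun y hy => ?_, ?_⟩
    · rw [Finset.mem_erase] at hy
      exact (Finset.mem_insert.1 (hS'.1 hy.2)).resolve_left hy.1
    · rcases eq_of_pair_laminar hF.2.1 hp hS hS'.2 hne with h | h
      · have h1 := Finset.card_lt_card (Finset.ssubset_iff_subset_ne.2 ⟨h, hne.symm⟩)
        have h2 := (hF.1 _ hp).2
        rw [Finset.card_erase_of_mem (h (by simp))]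
        omega
      · rw [Finset.erase_eq_of_notMem h.1]
        exact hS'.2
  · simp only [Finset.mem_image, Finset.mem_erase]
    rintro _ ⟨S, ⟨-, hS⟩, rfl⟩ _ ⟨T, ⟨-, hT⟩, rfl⟩
    rcases hF.2.1 S hS T hT with h | h | h
    · exact Or.inl (Finset.erase_subset_erase x h)
    · exact Or.inr (Or.inl (Finset.erase_subset_erase x h))
    · refine Or.inr (Or.inr (Finset.subset_empty.1 ?_))
      rw [← h]
      exact Finset.inter_subset_inter (Finset.erase_subset _ _) (Finset.erase_subset _ _)
  · refine Finset.mem_image.2 ⟨insert x A, Finset.mem_erase.2 ⟨fun h => ?_, hF.2.2⟩, ?_⟩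
    · have := Finset.card_le_two (a := x) (b := a)
      rw [← h, Finset.card_insert_of_notMem hx] at this
      omega
    · exact Finset.erase_insert hx

theorem IsRootedLaminar.insert_image_adjoinTwin {A : Finset α} {x a : α} {G : Finset (Finset α)}
    (hx : x ∉ A) (ha : a ∈ A) (hG : IsRootedLaminar A G) :
    IsRootedLaminar (insert x A) (insert {x, a} (G.image (adjoinTwin x a))) := by
  have hxa : a ≠ x := fun h => hx (h ▸ ha)
  have hpair : ∀ S ∈ G, {x, a} ⊆ adjoinTwin x a S ∨ adjoinTwin x a S ∩ {x, a} = ∅ := by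
    intro S hS
    have hxS : x ∉ S := fun h => hx ((hG.1 S hS).1 h)
    unfold adjoinTwin
    split_ifs with h
    · left; grind
    · right; grind
  refine ⟨?_, ?_, ?_⟩
  · simp only [Finset.mem_insert, Finset.mem_image]
    rintro _ (rfl | ⟨S, hS, rfl⟩)
    · exact ⟨by grind, (Finset.card_pair hxa.symm).ge⟩
    · have h := hG.1 S hS
      have hsub : S ⊆ adjoinTwin x a S := by unfold adjoinTwin; split_ifs <;> simp
      refine ⟨?_, h.2.trans (Finset.card_le_card hsub)⟩
      unfold adjoinTwin; split_ifs <;> grind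
  · simp only [Finset.mem_insert, Finset.mem_image]
    rintro _ (rfl | ⟨S, hS, rfl⟩) _ (rfl | ⟨T, hT, rfl⟩)
    · exact Or.inl subset_rfl
    · rcases hpair T hT with h | h
      · exact Or.inl h
      · exact Or.inr (Or.inr (by rw [Finset.inter_comm]; exact h))
    · exact Or.inr (hpair S hS)
    · exact adjoinTwin_laminar (fun h => hx ((hG.1 S hS).1 h)) (fun h => hx ((hG.1 T hT).1 h))
        (hG.2.1 S hS T hT)
  · refine Finset.mem_insert_of_mem (Finset.mem_image.2 ⟨A, hG.2.2, ?_⟩)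
    simp [adjoinTwin, ha]

theorem sum_rootedLaminar_pair_mem {A : Finset α} {x a : α} (hx : x ∉ A) (ha : a ∈ A)
    (hA : 2 ≤ A.card) :
    ∑ F ∈ (rootedLaminar (insert x A)).filter ({x, a} ∈ ·), (-1 : ℤ) ^ F.card =
      -∑ G ∈ rootedLaminar A, (-1 : ℤ) ^ G.card := by
  have hxa : a ≠ x := fun h => hx (h ▸ ha)
  have notMem : ∀ {G}, IsRootedLaminar A G → ∀ S ∈ G, x ∉ S :=
    fun hG S hS h => hx ((hG.1 S hS).1 h)
  have pair_notMem : ∀ {G}, IsRootedLaminar A G → {x, a} ∉ G.image (adjoinTwin x a) := by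
    intro G hG h
    obtain ⟨S, hS, h⟩ := Finset.mem_image.1 h
    exact adjoinTwin_ne_pair (notMem hG S hS) (hG.1 S hS).2 h
  have twin_erase : ∀ {F}, IsRootedLaminar (insert x A) F → {x, a} ∈ F →
      ∀ S ∈ F.erase {x, a}, adjoinTwin x a (S.erase x) = S := by
    intro F hF hp S hS
    rw [Finset.mem_erase] at hS
    exact adjoinTwin_erase hxa
      (eq_of_pair_laminar hF.2.1 hp hS.2 (hF.1 S hS.2).2 hS.1)
  rw [← Finset.sum_neg_distrib]
  refine Finset.sum_bij' (fun F _ => (F.erase {x, a}).image (·.erase x))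
    (fun G _ => insert {x, a} (G.image (adjoinTwin x a))) ?_ ?_ ?_ ?_ ?_
  · intro F hF
    rw [Finset.mem_filter, mem_rootedLaminar] at hF
    exact mem_rootedLaminar.2 (hF.1.image_erase hx hA hF.2)
  · intro G hG
    rw [mem_rootedLaminar] at hG
    rw [Finset.mem_filter, mem_rootedLaminar]
    exact ⟨hG.insert_image_adjoinTwin hx ha, Finset.mem_insert_self _ _⟩
  · intro F hF
    rw [Finset.mem_filter, mem_rootedLaminar] at hF
    simp only [Finset.image_image]
    rw [Finset.image_congr (g := id) fun S hS => by exact twin_erase hF.1 hF.2 S hS, Finset.image_id,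
      Finset.insert_erase hF.2]
  · intro G hG
    rw [mem_rootedLaminar] at hG
    simp only [Finset.erase_insert (pair_notMem hG), Finset.image_image]
    rw [Finset.image_congr (g := id) fun S hS => by exact erase_adjoinTwin (notMem hG S hS),
      Finset.image_id]
  · intro F hF
    rw [Finset.mem_filter, mem_rootedLaminar] at hF
    rw [Finset.card_image_of_injOn, ← Finset.card_erase_add_one hF.2, pow_succ, mul_neg_one]
    intro S hS T hT h
    rw [← twin_erase hF.1 hF.2 S hS, ← twin_erase hF.1 hF.2 T hT]
    exact congrArg _ h

theorem sum_rootedLaminar_insert {A : Finset α} {x : α} (hx : x ∉ A) (hA : 2 ≤ A.card) :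
    ∑ F ∈ rootedLaminar (insert x A), (-1 : ℤ) ^ F.card =
      -(A.card * ∑ G ∈ rootedLaminar A, (-1 : ℤ) ^ G.card) := by
  have hxA := Finset.mem_insert_self x A
  rw [← Finset.sum_filter_add_sum_filter_not _ (fun F => (hull (insert x A) x F).card = 2),
    sum_rootedLaminar_card_hull_ne_two hxA, add_zero]
  have : (rootedLaminar (insert x A)).filter (fun F => (hull (insert x A) x F).card = 2) =
      A.biUnion fun a => (rootedLaminar (insert x A)).filter ({x, a} ∈ ·) := by
    ext F
    simp only [Finset.mem_filter, Finset.mem_biUnion, mem_rootedLaminar]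
    constructor
    · rintro ⟨hF, h⟩
      obtain ⟨a, ha, hp⟩ := (hF.card_hull_eq_two_iff hxA).1 h
      rw [Finset.erase_insert hx] at ha
      exact ⟨a, ha, hF, hp⟩
    · rintro ⟨a, ha, hF, hp⟩
      exact ⟨hF, (hF.card_hull_eq_two_iff hxA).2 ⟨a, by rwa [Finset.erase_insert hx], hp⟩⟩
  rw [this, Finset.sum_biUnion,
    Finset.sum_congr rfl fun a ha => sum_rootedLaminar_pair_mem hx ha hA]
  · simp
  · intro a ha b hb hab
    refine Finset.disjoint_left.2 fun F hFa hFb => hab ?_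
    rw [Finset.mem_filter, mem_rootedLaminar] at hFa hFb
    have hax : a ≠ x := fun h => hx (h ▸ ha)
    by_contra hne
    have hpne : ({x, b} : Finset α) ≠ {x, a} := fun h => by
      have : a ∈ ({x, b} : Finset α) := by simp [h]
      simp [hax, hne] at this
    rcases eq_of_pair_laminar hFa.1.2.1 hFa.2 hFb.2 (hFa.1.1 _ hFb.2).2 hpne with h | h
    · have : a ∈ ({x, b} : Finset α) := h (by simp)
      simp [hax, hne] at this
    · simp at h

theorem rootedLaminar_of_card_eq_two {A : Finset α} (hA : A.card = 2) :
    rootedLaminar A = {{A}} := by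
  ext F
  rw [mem_rootedLaminar, Finset.mem_singleton]
  constructor
  · intro hF
    refine Finset.eq_singleton_iff_unique_mem.2 ⟨hF.2.2, fun S hS => ?_⟩
    exact Finset.eq_of_subset_of_card_le (hF.1 S hS).1 (hA.trans_le (hF.1 S hS).2)
  · rintro rfl
    simp [IsRootedLaminar, hA]

theorem sum_rootedLaminar (k : ℕ) (A : Finset α) (hA : A.card = k + 2) :
    ∑ F ∈ rootedLaminar A, (-1 : ℤ) ^ F.card = (-1) ^ (k + 1) * (k + 1).factorial := by
  induction k generalizing A with
  | zero => simp [rootedLaminar_of_card_eq_two hA]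
  | succ k ih =>
    obtain ⟨x, B, hx, rfl, hB⟩ := Finset.card_eq_succ.1 hA
    rw [sum_rootedLaminar_insert hx (by omega), ih B (by omega), hB,
      Nat.factorial_succ (k + 1)]
    push_cast
    ring

end RootedLaminar

theorem mem_whFaces {n : ℕ} {F : Finset (Finset ℕ)} : F ∈ whFaces n ↔ IsWhFace n F := by
  simp only [whFaces, Finset.mem_filter, Finset.mem_powerset, and_iff_right_iff_imp]
  exact fun h S hS => Finset.mem_powerset.2 (h.1 S hS).1

theorem sum_whFaces_eq_neg_sum_rootedLaminar {n : ℕ} (hn : 3 ≤ n) :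
    ∑ F ∈ whFaces n, (-1 : ℤ) ^ F.card =
      -∑ F ∈ rootedLaminar (Finset.Icc 2 n), (-1 : ℤ) ^ F.card := by
  have hcard : (Finset.Icc 2 n).card = n - 1 := by simp
  have top_notMem : ∀ {F}, IsWhFace n F → Finset.Icc 2 n ∉ F := fun hF h => by
    have := (hF.1 _ h).2.2
    omega
  rw [← Finset.sum_neg_distrib]
  refine Finset.sum_bij' (fun F _ => insert (Finset.Icc 2 n) F)
    (fun F _ => F.erase (Finset.Icc 2 n)) ?_ ?_ ?_ ?_ ?_
  · intro F hF
    rw [mem_whFaces] at hF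
    rw [mem_rootedLaminar]
    refine ⟨?_, ?_, Finset.mem_insert_self _ _⟩
    · intro S hS
      rcases Finset.mem_insert.1 hS with rfl | h
      · exact ⟨subset_rfl, by omega⟩
      · exact ⟨(hF.1 S h).1, (hF.1 S h).2.1⟩
    · intro S hS T hT
      rcases Finset.mem_insert.1 hS with rfl | h <;> rcases Finset.mem_insert.1 hT with rfl | h'
      · exact Or.inl subset_rfl
      · exact Or.inr (Or.inl (hF.1 T h').1)
      · exact Or.inl (hF.1 S h).1
      · exact hF.2 S h T h'
  · intro F hF
    rw [mem_rootedLaminar] at hF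
    rw [mem_whFaces]
    refine ⟨fun S hS => ?_, fun S hS T hT =>
      hF.2.1 S (Finset.mem_of_mem_erase hS) T (Finset.mem_of_mem_erase hT)⟩
    rw [Finset.mem_erase] at hS
    have h := hF.1 S hS.2
    have := Finset.card_lt_card (Finset.ssubset_iff_subset_ne.2 ⟨h.1, hS.1⟩)
    exact ⟨h.1, h.2, by omega⟩
  · intro F hF
    exact Finset.erase_insert (top_notMem (mem_whFaces.1 hF))
  · intro F hF
    exact Finset.insert_erase (mem_rootedLaminar.1 hF).2.2
  · intro F hF
    rw [Finset.card_insert_of_notMem (top_notMem (mem_whFaces.1 hF))]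
    ring

/-- The alternating sum `∑_F (-1)^{|F|}` over all faces of `Δ_n` (including the empty
face) equals `(-1)^{n-3} (n-2)!`; equivalently, the reduced Euler characteristic of
`Δ_n` is `(-1)^{n-4} (n-2)!`, as `Δ_n` is homotopy equivalent to a wedge of `(n-2)!`
spheres of dimension `n-4`. -/
theorem stmt13 (n : ℕ) (hn : 3 ≤ n) :
    ∑ F ∈ whFaces n, (-1 : ℤ) ^ F.card =
      (-1 : ℤ) ^ (n - 3) * Nat.factorial (n - 2) := by
  obtain ⟨k, rfl⟩ := Nat.exists_eq_add_of_le' hn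
  rw [sum_whFaces_eq_neg_sum_rootedLaminar hn, sum_rootedLaminar k _ (by simp)]
  simp only [Nat.add_sub_cancel, show k + 3 - 2 = k + 1 by omega]
  ring
end

section
/- Let n ≥ 3 and let F be a face of the Whitehouse complex Δ_n. Then the alternating sum over all faces G of the link of F in Δ_n (including the empty face) of (−1)^{|G|} equals (−1)^{n−3−|F|} · (c−1)! · Π_{T ∈ F} (c(T)−1)!, where c is the number of components of the forest representation of F and c(T) is the number of children of the node T in the forest representation of F. (This is the Euler-characteristic form of the statement that link_{Δ_n}(F) is a wedge of (c−1)!·Π_{T∈F}(c(T)−1)! spheres of dimension n−4−|F|, from which the Cohen–Macaulayness of Δ_n follows by Reisner's criterion.) -/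
open scoped Classical in
/-- The (finite) set of faces of the link of the face `F` in `Δ_n`:
all `G` with `F ∩ G = ∅` and `F ∪ G` a face of `Δ_n`. -/
noncomputable def whLinkFaces (n : ℕ) (F : Finset (Finset ℕ)) :
    Finset (Finset (Finset ℕ)) :=
  ((Finset.Icc 2 n).powerset.powerset).filter
    (fun G => Disjoint F G ∧ IsWhFace n (F ∪ G))

/-- The number `c` of components of the forest representation of a face `F` of `Δ_n`:
maximal elements of `F` plus elements of `{2,…,n}` lying in no member of `F`. -/
def whComps (n : ℕ) (F : Finset (Finset ℕ)) : ℕ :=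
  (F.filter (fun S => ∀ U ∈ F, ¬ S ⊂ U)).card +
  ((Finset.Icc 2 n).filter (fun i => ∀ S ∈ F, i ∉ S)).card

/-- The number `c(T)` of children of the node `T` in the forest representation of `F`:
maximal elements of `{S ∈ F : S ⊊ T}` plus elements of `T` in no `S ∈ F` with `S ⊊ T`. -/
def whChildren (F : Finset (Finset ℕ)) (T : Finset ℕ) : ℕ :=
  (F.filter (fun S => S ⊂ T ∧ ∀ U ∈ F, U ⊂ T → ¬ S ⊂ U)).card +
  (T.filter (fun i => ∀ S ∈ F, S ⊂ T → i ∉ S)).card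

section LaminarTrees

open Finset

variable {α : Type*}

/-- A laminar family of nonempty subsets of `X` containing `X` and all singletons,
i.e. a rooted tree with leaf set `X` without unary nodes. -/
structure IsLaminarTree (X : Finset α) (L : Finset (Finset α)) : Prop where
  root_mem : X ∈ L
  singleton_mem : ∀ i ∈ X, {i} ∈ L
  subset_root : ∀ S ∈ L, S ⊆ X
  nonempty : ∀ S ∈ L, S.Nonempty
  laminar : ∀ S ∈ L, ∀ T ∈ L, S ⊆ T ∨ T ⊆ S ∨ Disjoint S T

lemma IsLaminarTree.mono {X : Finset α} {G L : Finset (Finset α)} (hG : IsLaminarTree X G)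
    (hsub : L ⊆ G) (hX : X ∈ L) (hs : ∀ i ∈ X, {i} ∈ L) : IsLaminarTree X L :=
  ⟨hX, hs, fun S hS => hG.subset_root S (hsub hS), fun S hS => hG.nonempty S (hsub hS),
    fun S hS U hU => hG.laminar S (hsub hS) U (hsub hU)⟩

variable [DecidableEq α]

/-- The maximal members of `L` strictly below `T`. -/
def treeChildren (L : Finset (Finset α)) (T : Finset α) : Finset (Finset α) :=
  L.filter (fun S => S ⊂ T ∧ ∀ U ∈ L, U ⊂ T → ¬ S ⊂ U)

open scoped Classical in
/-- The laminar trees on `X` refining `L`. -/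
noncomputable def treesAbove (X : Finset α) (L : Finset (Finset α)) :
    Finset (Finset (Finset α)) :=
  X.powerset.powerset.filter (fun G => IsLaminarTree X G ∧ L ⊆ G)

variable {X : Finset α} {L : Finset (Finset α)} {S T : Finset α}

lemma mem_treeChildren :
    S ∈ treeChildren L T ↔ S ∈ L ∧ S ⊂ T ∧ ∀ U ∈ L, U ⊂ T → ¬ S ⊂ U := by
  simp [treeChildren]

lemma mem_treesAbove {G : Finset (Finset α)} :
    G ∈ treesAbove X L ↔ IsLaminarTree X G ∧ L ⊆ G := by
  simp only [treesAbove, mem_filter, mem_powerset, and_iff_right_iff_imp]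
  exact fun h S hS => mem_powerset.2 (h.1.subset_root S hS)

lemma exists_treeChildren_superset (hS : S ∈ L) (hST : S ⊂ T) :
    ∃ C ∈ treeChildren L T, S ⊆ C := by
  obtain ⟨C, hSC, hC⟩ := (L.filter (· ⊂ T)).exists_le_maximal (a := S) (by simp [hS, hST])
  have hC1 := mem_filter.1 hC.prop
  refine ⟨C, mem_treeChildren.2 ⟨hC1.1, hC1.2, fun U hU hUT hCU => ?_⟩, hSC⟩
  exact hCU.2 (hC.le_of_ge (mem_filter.2 ⟨hU, hUT⟩) hCU.1)

namespace IsLaminarTree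

lemma disjoint_children (h : IsLaminarTree X L) {C D : Finset α}
    (hC : C ∈ treeChildren L T) (hD : D ∈ treeChildren L T) (hne : C ≠ D) : Disjoint C D := by
  rw [mem_treeChildren] at hC hD
  rcases h.laminar C hC.1 D hD.1 with h1 | h1 | h1
  · exact absurd (h1.ssubset_of_ne hne) (hC.2.2 D hD.1 hD.2.1)
  · exact absurd (h1.ssubset_of_ne hne.symm) (hD.2.2 C hC.1 hC.2.1)
  · exact h1

lemma children_eq_of_mem (h : IsLaminarTree X L) {C D : Finset α} {i : α}
    (hC : C ∈ treeChildren L T) (hD : D ∈ treeChildren L T) (hiC : i ∈ C) (hiD : i ∈ D) :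
    C = D := by
  by_contra hne
  exact disjoint_left.1 (h.disjoint_children hC hD hne) hiC hiD

lemma nonempty_of_mem_children (h : IsLaminarTree X L) {C : Finset α}
    (hC : C ∈ treeChildren L T) : C.Nonempty :=
  h.nonempty C (mem_treeChildren.1 hC).1

lemma exists_child_mem (h : IsLaminarTree X L) (hT : T ∈ L) (hT2 : 2 ≤ #T) {i : α} (hi : i ∈ T) :
    ∃ C ∈ treeChildren L T, i ∈ C := by
  have hss : {i} ⊂ T := by
    refine (singleton_subset_iff.2 hi).ssubset_of_ne ?_
    rintro rfl
    simp at hT2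
  obtain ⟨C, hC, hiC⟩ := exists_treeChildren_superset
    (h.singleton_mem i (h.subset_root T hT hi)) hss
  exact ⟨C, hC, singleton_subset_iff.1 hiC⟩

lemma exists_child_ne (h : IsLaminarTree X L) (hT : T ∈ L) (hT2 : 2 ≤ #T) {C : Finset α}
    (hC : C ∈ treeChildren L T) : ∃ D ∈ treeChildren L T, D ≠ C := by
  obtain ⟨i, hiT, hiC⟩ := exists_of_ssubset (mem_treeChildren.1 hC).2.1
  obtain ⟨D, hD, hiD⟩ := h.exists_child_mem hT hT2 hiT
  exact ⟨D, hD, fun e => hiC (e ▸ hiD)⟩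

lemma two_le_card_children (h : IsLaminarTree X L) (hT : T ∈ L) (hT2 : 2 ≤ #T) :
    2 ≤ #(treeChildren L T) := by
  obtain ⟨i, hi⟩ := h.nonempty T hT
  obtain ⟨C, hC, -⟩ := h.exists_child_mem hT hT2 hi
  obtain ⟨D, hD, hne⟩ := h.exists_child_ne hT hT2 hC
  exact one_lt_card.2 ⟨D, hD, C, hC, hne⟩

lemma children_eq_empty (h : IsLaminarTree X L) (hT1 : #T ≤ 1) : treeChildren L T = ∅ := by
  refine eq_empty_of_forall_notMem fun C hC => ?_
  have h1 := card_lt_card (mem_treeChildren.1 hC).2.1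
  have h2 := (h.nonempty_of_mem_children hC).card_pos
  omega

/-- Every non-root node has exactly one parent. -/
lemma sum_card_children (h : IsLaminarTree X L) :
    ∑ T ∈ L, #(treeChildren L T) + 1 = #L := by
  have hU : L.biUnion (treeChildren L) = L.erase X := by
    ext S
    simp only [mem_biUnion, mem_erase]
    constructor
    · rintro ⟨T, hT, hS⟩
      rw [mem_treeChildren] at hS
      exact ⟨(hS.2.1.trans_subset (h.subset_root T hT)).ne, hS.1⟩
    · rintro ⟨hne, hS⟩
      obtain ⟨T, -, hT⟩ := (L.filter (S ⊂ ·)).exists_le_minimal (a := X)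
        (by simp [h.root_mem, (h.subset_root S hS).ssubset_of_ne hne])
      have hT1 := mem_filter.1 hT.prop
      refine ⟨T, hT1.1, mem_treeChildren.2 ⟨hS, hT1.2, fun U hU hUT hSU => ?_⟩⟩
      exact hUT.2 (hT.le_of_le (mem_filter.2 ⟨hU, hSU⟩) hUT.1)
  rw [← card_biUnion, hU, card_erase_add_one h.root_mem]
  intro T hT U hU hne
  refine disjoint_left.2 fun S hS hS' => ?_
  have hSne := h.nonempty_of_mem_children hS
  rw [mem_treeChildren] at hS hS'
  rcases h.laminar T hT U hU with h1 | h1 | h1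
  · exact hS'.2.2 T hT (h1.ssubset_of_ne hne) hS.2.1
  · exact hS.2.2 U hU (h1.ssubset_of_ne hne.symm) hS'.2.1
  · obtain ⟨i, hi⟩ := hSne
    exact disjoint_left.1 h1 (hS.2.1.1 hi) (hS'.2.1.1 hi)

lemma eq_of_subset_of_card_children_le (h : IsLaminarTree X L)
    (h2 : ∀ T ∈ L, #(treeChildren L T) ≤ 2) {G : Finset (Finset α)} (hG : IsLaminarTree X G)
    (hLG : L ⊆ G) : G = L := by
  refine (hLG.antisymm fun S hS => ?_).symm
  by_contra hSL
  obtain ⟨T, -, hT⟩ := (L.filter (S ⊆ ·)).exists_le_minimal (a := X)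
    (by simp [h.root_mem, hG.subset_root S hS])
  obtain ⟨hTL, hST⟩ := mem_filter.1 hT.prop
  have hne : S ≠ T := fun e => hSL (e ▸ hTL)
  have hss := hST.ssubset_of_ne hne
  have hT2 : 2 ≤ #T := by
    have := card_lt_card hss
    have := (hG.nonempty S hS).card_pos
    omega
  have key : ∀ C ∈ treeChildren L T, ∀ i ∈ C, i ∈ S → C ⊂ S := by
    intro C hC i hiC hiS
    have hC' := mem_treeChildren.1 hC
    rcases hG.laminar S hS C (hLG hC'.1) with h1 | h1 | h1
    · exact absurd (hT.le_of_le (mem_filter.2 ⟨hC'.1, h1⟩) hC'.2.1.1) hC'.2.1.2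
    · exact h1.ssubset_of_ne fun e => hSL (e ▸ hC'.1)
    · exact absurd hiC (disjoint_left.1 h1 hiS)
  obtain ⟨i, hi⟩ := hG.nonempty S hS
  obtain ⟨C, hC, hiC⟩ := h.exists_child_mem hTL hT2 (hST hi)
  have hCS := key C hC i hiC hi
  obtain ⟨j, hjS, hjC⟩ := exists_of_ssubset hCS
  obtain ⟨D, hD, hjD⟩ := h.exists_child_mem hTL hT2 (hST hjS)
  have hDS := key D hD j hjD hjS
  refine hss.2 fun k hk => ?_
  obtain ⟨E, hE, hkE⟩ := h.exists_child_mem hTL hT2 hk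
  by_cases hEC : E = C
  · exact hCS.1 (hEC ▸ hkE)
  by_cases hED : E = D
  · exact hDS.1 (hED ▸ hkE)
  have hCD : C ≠ D := fun e => hjC (e ▸ hjD)
  have := two_lt_card.2 ⟨E, hE, C, hC, D, hD, hEC, hED, hCD⟩
  have := h2 T hTL
  omega

lemma sum_treesAbove_of_card_children_le (h : IsLaminarTree X L)
    (h2 : ∀ T ∈ L, #(treeChildren L T) ≤ 2) :
    ∑ G ∈ treesAbove X L, (-1 : ℤ) ^ #G = -∏ T ∈ L, ((#(treeChildren L T) - 1).factorial : ℤ) := by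
  have h1 : treesAbove X L = {L} := by
    ext G
    rw [mem_treesAbove, mem_singleton]
    exact ⟨fun hG => h.eq_of_subset_of_card_children_le h2 hG.1 hG.2, fun e => by simp [e, h]⟩
  have hodd : Odd #L := by
    rw [← h.sum_card_children]
    refine Even.add_one (even_sum _ fun T hT => ?_)
    rcases Nat.lt_or_ge 1 #T with hT2 | hT2
    · rw [le_antisymm (h2 T hT) (h.two_le_card_children hT hT2)]
      exact even_two
    · simp [h.children_eq_empty hT2]
  rw [h1, sum_singleton, hodd.neg_one_pow, prod_eq_one]
  intro T hT
  have := h2 T hT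
  rw [Nat.factorial_eq_one.2 (by omega), Nat.cast_one]

lemma card_le (h : IsLaminarTree X L) : #L + 1 ≤ 2 * #X := by
  have h1 := h.sum_card_children
  have h2 : #(L.filter (fun T => 2 ≤ #T)) * 2 ≤ ∑ T ∈ L, #(treeChildren L T) := by
    rw [← smul_eq_mul]
    refine (card_nsmul_le_sum _ _ 2 fun T hT => ?_).trans
      (sum_le_sum_of_subset (filter_subset (fun T => 2 ≤ #T) L))
    exact h.two_le_card_children (mem_filter.1 hT).1 (mem_filter.1 hT).2
  have h3 : L.filter (fun T => ¬ 2 ≤ #T) ⊆ X.image singleton := by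
    intro T hT
    obtain ⟨hTL, hT1⟩ := mem_filter.1 hT
    have := (h.nonempty T hTL).card_pos
    obtain ⟨i, rfl⟩ := card_eq_one.1 (show #T = 1 by omega)
    exact mem_image_of_mem _ (h.subset_root _ hTL (mem_singleton_self i))
  have h4 := (card_le_card h3).trans card_image_le
  have h5 := card_filter_add_card_filter_not (s := L) (fun T => 2 ≤ #T)
  omega

end IsLaminarTree

namespace IsLaminarTree

section Split

variable {a b : Finset α}

/-- Removing a child from a node with at least three children gives a set not in the tree. -/
lemma sdiff_notMem (h : IsLaminarTree X L) (h3 : 3 ≤ #(treeChildren L T))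
    (hb : b ∈ treeChildren L T) : T \ b ∉ L := by
  intro hmem
  have hb' := mem_treeChildren.1 hb
  have hss : T \ b ⊂ T := sdiff_ssubset hb'.2.1.1 (h.nonempty_of_mem_children hb)
  obtain ⟨C, hC, hTC⟩ := exists_treeChildren_superset hmem hss
  have hlt : #({b, C} : Finset (Finset α)) < #(treeChildren L T) := card_le_two.trans_lt h3
  obtain ⟨D, hD, hDn⟩ := exists_mem_notMem_of_card_lt_card hlt
  simp only [mem_insert, mem_singleton, not_or] at hDn
  obtain ⟨i, hi⟩ := h.nonempty_of_mem_children hD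
  have hib : i ∉ b := disjoint_left.1 (h.disjoint_children hD hb hDn.1) hi
  have hiT : i ∈ T := (mem_treeChildren.1 hD).2.1.1 hi
  exact hDn.2 (h.children_eq_of_mem hD hC hi (hTC (mem_sdiff.2 ⟨hiT, hib⟩)))

lemma subset_sdiff_of_ssubset (h : IsLaminarTree X L) (hb : b ∈ treeChildren L T)
    (hS : S ∈ L) (hST : S ⊂ T) : S ⊆ b ∨ S ⊆ T \ b := by
  obtain ⟨C, hC, hSC⟩ := exists_treeChildren_superset hS hST
  rcases eq_or_ne C b with rfl | hne
  · exact Or.inl hSC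
  · exact Or.inr (subset_sdiff.2 ⟨hST.1, (h.disjoint_children hC hb hne).mono_left hSC⟩)

lemma insert_sdiff (h : IsLaminarTree X L) (hT : T ∈ L) {M : Finset α} (hM : M ⊂ T)
    (hsub : ∀ S ∈ L, S ⊂ T → S ⊆ M ∨ S ⊆ T \ M) : IsLaminarTree X (insert (T \ M) L) := by
  have key : ∀ S ∈ L, S ⊆ T \ M ∨ T \ M ⊆ S ∨ Disjoint S (T \ M) := by
    intro S hS
    rcases h.laminar S hS T hT with h1 | h1 | h1
    · rcases eq_or_ne S T with rfl | hne
      · exact Or.inr (Or.inl sdiff_subset)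
      · rcases hsub S hS (h1.ssubset_of_ne hne) with h2 | h2
        · exact Or.inr (Or.inr (disjoint_sdiff.mono_left h2))
        · exact Or.inl h2
    · exact Or.inr (Or.inl (sdiff_subset.trans h1))
    · exact Or.inr (Or.inr (h1.mono_right sdiff_subset))
  refine ⟨mem_insert_of_mem h.root_mem, fun i hi => mem_insert_of_mem (h.singleton_mem i hi),
    ?_, ?_, ?_⟩
  · rintro S hS
    rcases mem_insert.1 hS with rfl | hS
    · exact sdiff_subset.trans (h.subset_root T hT)
    · exact h.subset_root S hS
  · rintro S hS
    rcases mem_insert.1 hS with rfl | hS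
    · exact sdiff_nonempty.2 hM.2
    · exact h.nonempty S hS
  · intro S hS U hU
    rcases mem_insert.1 hS with rfl | hS <;> rcases mem_insert.1 hU with rfl | hU
    · exact Or.inl subset_rfl
    · rcases key U hU with h1 | h1 | h1
      · exact Or.inr (Or.inl h1)
      · exact Or.inl h1
      · exact Or.inr (Or.inr h1.symm)
    · exact key S hS
    · exact h.laminar S hS U hU

lemma split (h : IsLaminarTree X L) (hT : T ∈ L) (hb : b ∈ treeChildren L T) :
    IsLaminarTree X (insert (T \ b) L) :=
  h.insert_sdiff hT (mem_treeChildren.1 hb).2.1 fun _ hS hST => h.subset_sdiff_of_ssubset hb hS hST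

lemma ssubset_of_sdiff_ssubset (h : IsLaminarTree X L) (hT : T ∈ L)
    (h3 : 3 ≤ #(treeChildren L T)) (hb : b ∈ treeChildren L T) {U : Finset α} (hU : U ∈ L)
    (hss : T \ b ⊂ U) : T ⊆ U := by
  have hne : (T \ b).Nonempty := sdiff_nonempty.2 (mem_treeChildren.1 hb).2.1.2
  rcases h.laminar T hT U hU with h1 | h1 | h1
  · exact h1
  · rcases eq_or_ne U T with rfl | hUT
    · exact subset_rfl
    rcases h.subset_sdiff_of_ssubset hb hU (h1.ssubset_of_ne hUT) with h2 | h2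
    · obtain ⟨i, hi⟩ := hne
      exact absurd (h2 (hss.1 hi)) (mem_sdiff.1 hi).2
    · exact absurd h2 hss.2
  · obtain ⟨i, hi⟩ := hne
    exact absurd (hss.1 hi) (disjoint_left.1 h1 (mem_sdiff.1 hi).1)

lemma treeChildren_split_self (h : IsLaminarTree X L) (hb : b ∈ treeChildren L T) :
    treeChildren (insert (T \ b) L) T = {b, T \ b} := by
  have hb' := mem_treeChildren.1 hb
  have hbne := h.nonempty_of_mem_children hb
  have hss : T \ b ⊂ T := sdiff_ssubset hb'.2.1.1 hbne
  have hTb : (T \ b).Nonempty := sdiff_nonempty.2 hb'.2.1.2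
  ext S
  simp only [mem_treeChildren, mem_insert, mem_singleton]
  constructor
  · rintro ⟨hS, hST, hmax⟩
    rcases hS with rfl | hS
    · exact Or.inr rfl
    rcases h.subset_sdiff_of_ssubset hb hS hST with h1 | h1
    · left
      by_contra hne
      exact hmax b (Or.inr hb'.1) hb'.2.1 (h1.ssubset_of_ne hne)
    · right
      by_contra hne
      exact hmax _ (Or.inl rfl) hss (h1.ssubset_of_ne hne)
  · rintro (rfl | rfl)
    · refine ⟨Or.inr hb'.1, hb'.2.1, fun U hU hUT hSU => ?_⟩
      rcases hU with rfl | hU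
      · obtain ⟨i, hi⟩ := hbne
        exact (mem_sdiff.1 (hSU.1 hi)).2 hi
      · exact hb'.2.2 U hU hUT hSU
    · refine ⟨Or.inl rfl, hss, fun U hU hUT hSU => ?_⟩
      rcases hU with rfl | hU
      · exact hSU.2 subset_rfl
      rcases h.subset_sdiff_of_ssubset hb hU hUT with h1 | h1
      · obtain ⟨i, hi⟩ := hTb
        exact (mem_sdiff.1 hi).2 (h1 (hSU.1 hi))
      · exact hSU.2 h1

lemma treeChildren_split_sdiff (h : IsLaminarTree X L)
    (h3 : 3 ≤ #(treeChildren L T)) (hb : b ∈ treeChildren L T) :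
    treeChildren (insert (T \ b) L) (T \ b) = (treeChildren L T).erase b := by
  have hnm := h.sdiff_notMem h3 hb
  have hb' := mem_treeChildren.1 hb
  have hbne := h.nonempty_of_mem_children hb
  have hss : T \ b ⊂ T := sdiff_ssubset hb'.2.1.1 hbne
  have hTb : (T \ b).Nonempty := sdiff_nonempty.2 hb'.2.1.2
  ext S
  rw [mem_erase, mem_treeChildren, mem_treeChildren]
  constructor
  · rintro ⟨hS, hST, hmax⟩
    rcases mem_insert.1 hS with rfl | hS
    · exact absurd subset_rfl hST.2
    refine ⟨?_, hS, hST.trans hss, fun U hU hUT hSU => ?_⟩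
    · rintro rfl
      obtain ⟨i, hi⟩ := hbne
      exact (mem_sdiff.1 (hST.1 hi)).2 hi
    · rcases h.subset_sdiff_of_ssubset hb hU hUT with h1 | h1
      · obtain ⟨i, hi⟩ := h.nonempty S hS
        exact (mem_sdiff.1 (hST.1 hi)).2 (h1 (hSU.1 hi))
      · exact hmax U (mem_insert_of_mem hU) (h1.ssubset_of_ne fun e => hnm (e ▸ hU)) hSU
  · rintro ⟨hne, hS, hST, hmax⟩
    refine ⟨mem_insert_of_mem hS, ?_, fun U hU hUT hSU => ?_⟩
    · rcases h.subset_sdiff_of_ssubset hb hS hST with h1 | h1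
      · exact absurd (h1.ssubset_of_ne hne) (hmax b hb'.1 hb'.2.1)
      · exact h1.ssubset_of_ne fun e => hnm (e ▸ hS)
    · rcases mem_insert.1 hU with rfl | hU
      · exact hUT.2 subset_rfl
      · exact hmax U hU (hUT.trans hss) hSU

lemma treeChildren_split_of_ne (h : IsLaminarTree X L) (hT : T ∈ L)
    (h3 : 3 ≤ #(treeChildren L T)) (hb : b ∈ treeChildren L T) {U : Finset α} (hU : U ∈ L)
    (hne : U ≠ T) : treeChildren (insert (T \ b) L) U = treeChildren L U := by
  have hss : T \ b ⊂ T :=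
    sdiff_ssubset (mem_treeChildren.1 hb).2.1.1 (h.nonempty_of_mem_children hb)
  have hTU : T \ b ⊂ U → T ⊂ U := fun hs =>
    (h.ssubset_of_sdiff_ssubset hT h3 hb hU hs).ssubset_of_ne hne.symm
  ext S
  rw [mem_treeChildren, mem_treeChildren]
  constructor
  · rintro ⟨hS, hSU, hmax⟩
    rcases mem_insert.1 hS with rfl | hS
    · exact absurd hss (hmax T (mem_insert_of_mem hT) (hTU hSU))
    · exact ⟨hS, hSU, fun V hV => hmax V (mem_insert_of_mem hV)⟩
  · rintro ⟨hS, hSU, hmax⟩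
    refine ⟨mem_insert_of_mem hS, hSU, fun V hV hVU hSV => ?_⟩
    rcases mem_insert.1 hV with rfl | hV
    · exact hmax T hT (hTU hVU) (hSV.trans hss)
    · exact hmax V hV hVU hSV

lemma prod_factorial_split (h : IsLaminarTree X L) (hT : T ∈ L)
    (h3 : 3 ≤ #(treeChildren L T)) (hb : b ∈ treeChildren L T) :
    ∏ U ∈ insert (T \ b) L, ((#(treeChildren (insert (T \ b) L) U) - 1).factorial : ℤ) =
      ((#(treeChildren L T) - 2).factorial : ℤ) *
        ∏ U ∈ L.erase T, ((#(treeChildren L U) - 1).factorial : ℤ) := by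
  have h2 : #({b, T \ b} : Finset (Finset α)) - 1 ≤ 1 := by
    have : #({b, T \ b} : Finset (Finset α)) ≤ 2 := card_le_two
    omega
  rw [prod_insert (h.sdiff_notMem h3 hb), h.treeChildren_split_sdiff h3 hb,
    card_erase_of_mem hb, Nat.sub_sub, ← mul_prod_erase L _ hT, h.treeChildren_split_self hb,
    Nat.factorial_eq_one.2 h2, Nat.cast_one, one_mul]
  congr 1
  refine prod_congr rfl fun U hU => ?_
  rw [h.treeChildren_split_of_ne hT h3 hb (mem_of_mem_erase hU) (ne_of_mem_erase hU)]

end Split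

end IsLaminarTree

/-- The largest member of `G` strictly below `T` and containing `a` (for `a ∈ G` laminar). -/
def branch (a T : Finset α) (G : Finset (Finset α)) : Finset α :=
  (G.filter (fun U => a ⊆ U ∧ U ⊂ T)).sup id

namespace IsLaminarTree

section Toggle

variable {a b : Finset α} {G : Finset (Finset α)}

lemma branch_mem (hG : IsLaminarTree X G) (ha : a ∈ G) (haT : a ⊂ T) :
    branch a T G ∈ G ∧ a ⊆ branch a T G ∧ branch a T G ⊂ T := by
  obtain ⟨M, haM, hM⟩ := (G.filter (fun U => a ⊆ U ∧ U ⊂ T)).exists_le_maximal (a := a)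
    (by simp [ha, haT])
  have hM' := mem_filter.1 hM.prop
  have : branch a T G = M := by
    refine le_antisymm (Finset.sup_le fun U hU => ?_) (le_sup (f := id) hM.prop)
    have hU' := mem_filter.1 hU
    rcases hG.laminar U hU'.1 M hM'.1 with h1 | h1 | h1
    · exact h1
    · exact hM.le_of_ge hU h1
    · obtain ⟨i, hi⟩ := hG.nonempty a ha
      exact absurd (haM hi) (disjoint_left.1 h1 (hU'.2.1 hi))
  rw [this]
  exact hM'

lemma subset_branch {U : Finset α} (hU : U ∈ G) (haU : a ⊆ U) (hUT : U ⊂ T) :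
    U ⊆ branch a T G :=
  le_sup (f := id) (mem_filter.2 ⟨hU, haU, hUT⟩)

lemma branch_congr {G' : Finset (Finset α)}
    (h : ∀ U, a ⊆ U → (U ∈ G' ↔ U ∈ G)) : branch a T G' = branch a T G := by
  unfold branch
  congr 1
  ext U
  simp only [mem_filter]
  constructor
  · rintro ⟨h1, h2, h3⟩
    exact ⟨(h U h2).1 h1, h2, h3⟩
  · rintro ⟨h1, h2, h3⟩
    exact ⟨(h U h2).2 h1, h2, h3⟩

lemma insert_sdiff_branch (hG : IsLaminarTree X G) (hT : T ∈ G) (ha : a ∈ G) (haT : a ⊂ T) :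
    IsLaminarTree X (insert (T \ branch a T G) G) := by
  obtain ⟨hM, haM, hMT⟩ := hG.branch_mem ha haT
  refine hG.insert_sdiff hT hMT fun S hS hST => ?_
  rcases hG.laminar S hS _ hM with h1 | h1 | h1
  · exact Or.inl h1
  · exact Or.inl (subset_branch hS (haM.trans h1) hST)
  · exact Or.inr (subset_sdiff.2 ⟨hST.1, h1⟩)

lemma sdiff_branch_notMem (h : IsLaminarTree X L) (hG : IsLaminarTree X G) (hLG : L ⊆ G)
    (ha : a ∈ treeChildren L T)
    (hno : ∀ b ∈ (treeChildren L T).erase a, T \ b ∉ G) : T \ branch a T G ∉ L := by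
  intro hmem
  have ha' := mem_treeChildren.1 ha
  have hane := h.nonempty_of_mem_children ha
  obtain ⟨hM, haM, hMT⟩ := hG.branch_mem (hLG ha'.1) ha'.2.1
  have hss : T \ branch a T G ⊂ T := sdiff_ssubset hMT.1 (hane.mono haM)
  obtain ⟨C, hC, hTC⟩ := exists_treeChildren_superset hmem hss
  obtain ⟨i, hi⟩ := h.nonempty _ hmem
  have hCa : C ≠ a := by
    rintro rfl
    exact (mem_sdiff.1 hi).2 (haM (hTC hi))
  have hC' := mem_treeChildren.1 hC
  rcases hG.laminar C (hLG hC'.1) _ hM with h1 | h1 | h1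
  · exact (mem_sdiff.1 hi).2 (h1 (hTC hi))
  · obtain ⟨j, hj⟩ := hane
    exact hCa (h.children_eq_of_mem hC ha (h1 (haM hj)) hj)
  · refine hno C (mem_erase.2 ⟨hCa, hC⟩) ?_
    have : T \ C = branch a T G := by
      refine subset_antisymm ?_ (subset_sdiff.2 ⟨hMT.1, h1.symm⟩)
      intro j hj
      by_contra hjM
      exact (mem_sdiff.1 hj).2 (hTC (mem_sdiff.2 ⟨(mem_sdiff.1 hj).1, hjM⟩))
    rwa [this]

lemma sum_treesAbove_eq_zero (h : IsLaminarTree X L) (hT : T ∈ L) (ha : a ∈ treeChildren L T) :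
    ∑ G ∈ (treesAbove X L).filter (fun G => ∀ b ∈ (treeChildren L T).erase a, T \ b ∉ G),
      (-1 : ℤ) ^ #G = 0 := by
  have ha' := mem_treeChildren.1 ha
  have hane := h.nonempty_of_mem_children ha
  have haB : ∀ {G}, G ∈ (treesAbove X L).filter
      (fun G => ∀ b ∈ (treeChildren L T).erase a, T \ b ∉ G) → a ⊆ branch a T G := fun hG =>
    ((mem_treesAbove.1 (mem_filter.1 hG).1).1.branch_mem
      ((mem_treesAbove.1 (mem_filter.1 hG).1).2 ha'.1) ha'.2.1).2.1
  have hna : ∀ {M : Finset α}, a ⊆ M → ∀ U, a ⊆ U → U ≠ T \ M := by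
    rintro M haM U haU rfl
    obtain ⟨i, hi⟩ := hane
    exact (mem_sdiff.1 (haU hi)).2 (haM hi)
  have hB1 : ∀ {G : Finset (Finset α)} {M : Finset α}, a ⊆ M →
      branch a T (insert (T \ M) G) = branch a T G := fun haM =>
    branch_congr fun U hU => by simp [hna haM U hU]
  have hB2 : ∀ {G : Finset (Finset α)} {M : Finset α}, a ⊆ M →
      branch a T (G.erase (T \ M)) = branch a T G := fun haM =>
    branch_congr fun U hU => by simp [hna haM U hU]
  refine sum_involution (fun G _ => if T \ branch a T G ∈ G then G.erase (T \ branch a T G)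
    else insert (T \ branch a T G) G) ?_ ?_ ?_ ?_
  · intro G hG
    split_ifs with hm
    · rw [← card_erase_add_one hm, pow_succ]
      ring
    · rw [card_insert_of_notMem hm, pow_succ]
      ring
  · intro G hG _
    split_ifs with hm
    · exact fun e => erase_eq_self.1 e hm
    · exact fun e => hm (insert_eq_self.1 e)
  · intro G hG
    obtain ⟨hG1, hno⟩ := mem_filter.1 hG
    obtain ⟨hGt, hLG⟩ := mem_treesAbove.1 hG1
    have hnm := h.sdiff_branch_notMem hGt hLG ha hno
    split_ifs with hm
    · have hLG' : L ⊆ G.erase (T \ branch a T G) := fun S hS =>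
        mem_erase.2 ⟨fun e => hnm (e ▸ hS), hLG hS⟩
      refine mem_filter.2 ⟨mem_treesAbove.2 ⟨hGt.mono (erase_subset _ _)
        (hLG' h.root_mem) fun i hi => hLG' (h.singleton_mem i hi), hLG'⟩, fun b hb hbG => ?_⟩
      exact hno b hb (mem_of_mem_erase hbG)
    · refine mem_filter.2 ⟨mem_treesAbove.2 ⟨hGt.insert_sdiff_branch (hLG hT) (hLG ha'.1) ha'.2.1,
        hLG.trans (subset_insert _ _)⟩, fun b hb hbG => ?_⟩
      rcases mem_insert.1 hbG with e | hbG
      · have hd := h.disjoint_children (mem_of_mem_erase hb) ha (ne_of_mem_erase hb)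
        exact hna (haB hG) (T \ b) (subset_sdiff.2 ⟨ha'.2.1.1, hd.symm⟩) e
      · exact hno b hb hbG
  · intro G hG
    have haM := haB hG
    by_cases hm : T \ branch a T G ∈ G
    · simp only [hm, if_true, hB2 haM, notMem_erase, if_false, insert_erase hm]
    · simp only [hm, if_false, hB1 haM, mem_insert_self, if_true, erase_insert hm]

lemma sum_treesAbove_split (h : IsLaminarTree X L) (hT : T ∈ L) (ha : a ∈ treeChildren L T) :
    ∑ G ∈ treesAbove X L, (-1 : ℤ) ^ #G =
      ∑ b ∈ (treeChildren L T).erase a, ∑ G ∈ treesAbove X (insert (T \ b) L), (-1 : ℤ) ^ #G := by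
  rw [← sum_filter_add_sum_filter_not (treesAbove X L)
    (fun G => ∀ b ∈ (treeChildren L T).erase a, T \ b ∉ G), h.sum_treesAbove_eq_zero hT ha,
    zero_add, ← sum_biUnion]
  · congr 1
    ext G
    simp only [mem_filter, mem_biUnion, mem_treesAbove, insert_subset_iff, not_forall, not_not]
    constructor
    · rintro ⟨⟨h1, h2⟩, b, hb, h3⟩
      exact ⟨b, hb, h1, h3, h2⟩
    · rintro ⟨b, hb, h1, h3, h2⟩
      exact ⟨⟨h1, h2⟩, b, hb, h3⟩
  · intro b hb c hc hne
    refine disjoint_left.2 fun G hGb hGc => ?_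
    obtain ⟨hb1, hb2⟩ := mem_erase.1 hb
    obtain ⟨hc1, hc2⟩ := mem_erase.1 hc
    obtain ⟨hG, hGb⟩ := mem_treesAbove.1 hGb
    have hGc := (mem_treesAbove.1 hGc).2
    have hbc := h.disjoint_children hb2 hc2 hne
    have hbT := (mem_treeChildren.1 hb2).2.1.1
    have hcT := (mem_treeChildren.1 hc2).2.1.1
    have haT := (mem_treeChildren.1 ha).2.1.1
    obtain ⟨i, hi⟩ := h.nonempty_of_mem_children hb2
    obtain ⟨j, hj⟩ := h.nonempty_of_mem_children hc2
    obtain ⟨k, hk⟩ := h.nonempty_of_mem_children ha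
    have hib := disjoint_left.1 hbc hi
    have hjb := disjoint_right.1 hbc hj
    have hkb := disjoint_right.1 (h.disjoint_children hb2 ha hb1) hk
    have hkc := disjoint_right.1 (h.disjoint_children hc2 ha hc1) hk
    rcases hG.laminar _ (hGb (mem_insert_self _ _)) _ (hGc (mem_insert_self _ _)) with h1 | h1 | h1
    · exact (mem_sdiff.1 (h1 (mem_sdiff.2 ⟨hcT hj, hjb⟩))).2 hj
    · exact (mem_sdiff.1 (h1 (mem_sdiff.2 ⟨hbT hi, hib⟩))).2 hi
    · exact disjoint_left.1 h1 (mem_sdiff.2 ⟨haT hk, hkb⟩) (mem_sdiff.2 ⟨haT hk, hkc⟩)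

end Toggle

theorem sum_treesAbove (h : IsLaminarTree X L) :
    ∑ G ∈ treesAbove X L, (-1 : ℤ) ^ #G = -∏ T ∈ L, ((#(treeChildren L T) - 1).factorial : ℤ) := by
  induction hk : 2 * #X - #L using Nat.strong_induction_on generalizing L with
  | _ k ih =>
  by_cases h2 : ∀ T ∈ L, #(treeChildren L T) ≤ 2
  · exact h.sum_treesAbove_of_card_children_le h2
  push Not at h2
  obtain ⟨T, hT, h3⟩ := h2
  obtain ⟨a, ha⟩ := card_pos.1 (show 0 < #(treeChildren L T) by omega)
  have hstep : ∀ b ∈ (treeChildren L T).erase a,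
      ∑ G ∈ treesAbove X (insert (T \ b) L), (-1 : ℤ) ^ #G =
      -(((#(treeChildren L T) - 2).factorial : ℤ) *
        ∏ U ∈ L.erase T, ((#(treeChildren L U) - 1).factorial : ℤ)) := by
    intro b hb
    have hb := mem_of_mem_erase hb
    have hs := h.split hT hb
    have hc := card_insert_of_notMem (h.sdiff_notMem h3 hb)
    have hle := hs.card_le
    rw [ih _ (by omega) hs rfl, h.prod_factorial_split hT h3 hb]
  rw [h.sum_treesAbove_split hT ha, sum_congr rfl hstep, sum_const, card_erase_of_mem ha,
    ← mul_prod_erase L _ hT, nsmul_eq_mul, mul_neg, ← mul_assoc, ← Nat.cast_mul]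
  obtain ⟨m, hm⟩ : ∃ m, #(treeChildren L T) = m + 2 := ⟨_, (Nat.sub_add_cancel h3.le).symm⟩
  rw [hm, show m + 2 - 1 = m + 1 by omega, Nat.add_sub_cancel, Nat.factorial_succ]

end IsLaminarTree

/-- The tree on `{2,…,n}` obtained from `F` by adding the root and the leaves. -/
def whTree (n : ℕ) (F : Finset (Finset ℕ)) : Finset (Finset ℕ) :=
  insert (Icc 2 n) (F ∪ (Icc 2 n).image singleton)

section Whitehouse

variable {n : ℕ} {F G : Finset (Finset ℕ)} {S T : Finset ℕ}

lemma mem_whTree : S ∈ whTree n F ↔ S = Icc 2 n ∨ S ∈ F ∨ ∃ i ∈ Icc 2 n, {i} = S := by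
  simp only [whTree, mem_insert, mem_union, mem_image]

lemma whTree_union : whTree n (F ∪ G) = whTree n F ∪ G := by
  ext S
  simp only [mem_whTree, mem_union]
  generalize (∃ i ∈ Icc 2 n, {i} = S) = p
  tauto

lemma subset_whTree : F ⊆ whTree n F := fun _ hS => mem_whTree.2 (Or.inr (Or.inl hS))

namespace IsWhFace

lemma two_le_card (hF : IsWhFace n F) (hS : S ∈ F) : 2 ≤ #S := (hF.1 S hS).2.1

lemma root_notMem (hF : IsWhFace n F) (hn : 3 ≤ n) : Icc 2 n ∉ F := fun h => by
  have := (hF.1 _ h).2.2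
  rw [Nat.card_Icc] at this
  omega

lemma isLaminarTree (hF : IsWhFace n F) (hn : 3 ≤ n) : IsLaminarTree (Icc 2 n) (whTree n F) := by
  have hsub : ∀ S ∈ whTree n F, S ⊆ Icc 2 n := by
    intro S hS
    rcases mem_whTree.1 hS with rfl | hS | ⟨i, hi, rfl⟩
    · exact subset_rfl
    · exact (hF.1 S hS).1
    · exact singleton_subset_iff.2 hi
  have hsingle : ∀ (i : ℕ) (U : Finset ℕ), {i} ⊆ U ∨ Disjoint {i} U := fun i U => by
    rw [singleton_subset_iff, disjoint_singleton_left]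
    exact em _
  refine ⟨mem_whTree.2 (Or.inl rfl), fun i hi => mem_whTree.2 (Or.inr (Or.inr ⟨i, hi, rfl⟩)),
    hsub, fun S hS => ?_, fun S hS T hT => ?_⟩
  · rcases mem_whTree.1 hS with rfl | hS | ⟨i, hi, rfl⟩
    · exact nonempty_Icc.2 (by omega)
    · exact card_pos.1 (by have := hF.two_le_card hS; omega)
    · exact singleton_nonempty i
  · rcases mem_whTree.1 hS with rfl | hS' | ⟨i, hi, rfl⟩
    · exact Or.inr (Or.inl (hsub T hT))
    · rcases mem_whTree.1 hT with rfl | hT' | ⟨j, hj, rfl⟩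
      · exact Or.inl (hsub S hS)
      · simpa only [disjoint_iff_inter_eq_empty] using hF.2 S hS' T hT'
      · rcases hsingle j S with h | h
        · exact Or.inr (Or.inl h)
        · exact Or.inr (Or.inr h.symm)
    · rcases hsingle i T with h | h
      · exact Or.inl h
      · exact Or.inr (Or.inr h)

lemma notMem_whTree (hFG : IsWhFace n (F ∪ G)) (hn : 3 ≤ n) (hd : Disjoint F G) (hS : S ∈ G) :
    S ∉ whTree n F := by
  intro h
  rcases mem_whTree.1 h with rfl | h | ⟨i, -, rfl⟩
  · exact hFG.root_notMem hn (mem_union_right F hS)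
  · exact disjoint_left.1 hd h hS
  · have := hFG.two_le_card (mem_union_right F hS)
    simp at this

lemma card_whTree (hF : IsWhFace n F) (hn : 3 ≤ n) : #(whTree n F) = n + #F := by
  have hd : Disjoint F ((Icc 2 n).image singleton) := disjoint_left.2 fun S hS h => by
    obtain ⟨i, -, rfl⟩ := mem_image.1 h
    have := hF.two_le_card hS
    simp at this
  have hX : Icc 2 n ∉ F ∪ (Icc 2 n).image singleton := fun h => by
    rcases mem_union.1 h with h | h
    · exact hF.root_notMem hn h
    · obtain ⟨i, -, hi⟩ := mem_image.1 h
      have := congrArg card hi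
      rw [card_singleton, Nat.card_Icc] at this
      omega
  rw [whTree, card_insert_of_notMem hX, card_union_of_disjoint hd,
    card_image_of_injective _ singleton_injective, Nat.card_Icc]
  omega

lemma card_treeChildren (hF : IsWhFace n F) (hT : T ⊆ Icc 2 n) (hT2 : 2 ≤ #T) :
    #(treeChildren (whTree n F) T) = whChildren F T := by
  have hss : ∀ {i : ℕ} {U : Finset ℕ}, 2 ≤ #U → i ∈ U → {i} ⊂ U := fun hU hi =>
    (singleton_subset_iff.2 hi).ssubset_of_ne fun e => by simp [← e] at hU
  have hleaf : ∀ {i : ℕ} {S : Finset ℕ}, S.Nonempty → ¬ S ⊂ {i} := fun hS h =>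
    hS.ne_empty (ssubset_singleton_iff.1 h)
  have hne : ∀ S ∈ F, S.Nonempty := fun S hS => card_pos.1 (by
    have := hF.two_le_card hS
    omega)
  have hd : Disjoint (F.filter (fun S => S ⊂ T ∧ ∀ U ∈ F, U ⊂ T → ¬ S ⊂ U))
      ((T.filter (fun i => ∀ S ∈ F, S ⊂ T → i ∉ S)).image singleton) :=
    disjoint_left.2 fun S hS h => by
      obtain ⟨i, -, rfl⟩ := mem_image.1 h
      have := hF.two_le_card (mem_filter.1 hS).1
      simp at this
  have hmax : ∀ {S : Finset ℕ}, S.Nonempty →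
      ((∀ U ∈ whTree n F, U ⊂ T → ¬ S ⊂ U) ↔ ∀ U ∈ F, U ⊂ T → ¬ S ⊂ U) := by
    intro S hS
    refine ⟨fun h U hU => h U (subset_whTree hU), fun h U hU hUT hSU => ?_⟩
    rcases mem_whTree.1 hU with rfl | hU | ⟨j, -, rfl⟩
    · exact hUT.2 hT
    · exact h U hU hUT hSU
    · exact hleaf hS hSU
  rw [whChildren, ← card_image_of_injective (T.filter _) singleton_injective,
    ← card_union_of_disjoint hd]
  congr 1
  ext S
  simp only [mem_treeChildren, mem_union, mem_filter, mem_image]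
  constructor
  · rintro ⟨hS, hST, h⟩
    rcases mem_whTree.1 hS with rfl | hS | ⟨i, hi, rfl⟩
    · exact absurd hT hST.2
    · exact Or.inl ⟨hS, hST, (hmax (hne S hS)).1 h⟩
    · refine Or.inr ⟨i, ⟨singleton_subset_iff.1 hST.1, fun U hU hUT hiU => ?_⟩, rfl⟩
      exact h U (subset_whTree hU) hUT (hss (hF.two_le_card hU) hiU)
  · rintro (⟨hS, hST, h⟩ | ⟨i, ⟨hi, h⟩, rfl⟩)
    · exact ⟨subset_whTree hS, hST, (hmax (hne S hS)).2 h⟩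
    · refine ⟨mem_whTree.2 (Or.inr (Or.inr ⟨i, hT hi, rfl⟩)), hss hT2 hi,
        (hmax (singleton_nonempty i)).2 fun U hU hUT hiU => h U hU hUT ?_⟩
      exact singleton_subset_iff.1 hiU.1

lemma whChildren_root (hF : IsWhFace n F) (hn : 3 ≤ n) :
    whChildren F (Icc 2 n) = whComps n F := by
  have hss : ∀ S ∈ F, S ⊂ Icc 2 n := fun S hS =>
    (hF.1 S hS).1.ssubset_of_ne fun e => hF.root_notMem hn (e ▸ hS)
  unfold whChildren whComps
  congr 2
  · refine filter_congr fun S hS => ?_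
    exact ⟨fun h U hU => h.2 U hU (hss U hU), fun h => ⟨hss S hS, fun U hU _ => h U hU⟩⟩
  · refine filter_congr fun i _ => ?_
    exact ⟨fun h S hS => h S hS (hss S hS), fun h S hS _ => h S hS⟩

lemma prod_whTree (hF : IsWhFace n F) (hn : 3 ≤ n) :
    ∏ T ∈ whTree n F, ((#(treeChildren (whTree n F) T) - 1).factorial : ℤ) =
      (whComps n F - 1).factorial * ∏ T ∈ F, ((whChildren F T - 1).factorial : ℤ) := by
  have hcard : 2 ≤ #(Icc 2 n) := by
    rw [Nat.card_Icc]
    omega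
  have hsub : insert (Icc 2 n) F ⊆ whTree n F :=
    insert_subset (mem_whTree.2 (Or.inl rfl)) subset_whTree
  rw [← prod_subset hsub, prod_insert (hF.root_notMem hn), hF.card_treeChildren subset_rfl hcard,
    hF.whChildren_root hn]
  · congr 1
    refine prod_congr rfl fun T hT => ?_
    rw [hF.card_treeChildren (hF.1 T hT).1 (hF.two_le_card hT)]
  · intro T hT hT'
    rcases mem_whTree.1 hT with rfl | h | ⟨i, -, rfl⟩
    · exact absurd (mem_insert_self _ _) hT'
    · exact absurd (mem_insert_of_mem h) hT'
    · simp [(hF.isLaminarTree hn).children_eq_empty]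

lemma of_isLaminarTree (h : IsLaminarTree (Icc 2 n) G) (hFG : ∀ S ∈ F, S ∈ G)
    (hF : ∀ S ∈ F, S ≠ Icc 2 n ∧ ∀ i ∈ Icc 2 n, {i} ≠ S) : IsWhFace n F := by
  refine ⟨fun S hS => ⟨h.subset_root S (hFG S hS), ?_, ?_⟩, fun S hS T hT => ?_⟩
  · by_contra hlt
    have := (h.nonempty S (hFG S hS)).card_pos
    obtain ⟨i, rfl⟩ := card_eq_one.1 (show #S = 1 by omega)
    exact (hF _ hS).2 i (h.subset_root _ (hFG _ hS) (mem_singleton_self i)) rfl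
  · have := card_lt_card ((h.subset_root S (hFG S hS)).ssubset_of_ne (hF S hS).1)
    rw [Nat.card_Icc] at this
    omega
  · simpa only [disjoint_iff_inter_eq_empty] using h.laminar S (hFG S hS) T (hFG T hT)

lemma sum_whLinkFaces (hF : IsWhFace n F) (hn : 3 ≤ n) :
    ∑ G ∈ treesAbove (Icc 2 n) (whTree n F), (-1 : ℤ) ^ #G =
      (-1) ^ (n + #F) * ∑ G ∈ whLinkFaces n F, (-1 : ℤ) ^ #G := by
  rw [mul_sum, ← hF.card_whTree hn]
  symm
  have hlink : ∀ {G}, G ∈ whLinkFaces n F ↔ Disjoint F G ∧ IsWhFace n (F ∪ G) := by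
    intro G
    simp only [whLinkFaces, mem_filter, mem_powerset, and_iff_right_iff_imp]
    exact fun h S hS => mem_powerset.2 (h.2.1 S (mem_union_right F hS)).1
  have hdisj : ∀ {G}, G ∈ whLinkFaces n F → Disjoint (whTree n F) G := fun hG =>
    disjoint_right.2 fun S hS => (hlink.1 hG).2.notMem_whTree hn (hlink.1 hG).1 hS
  refine sum_bij' (fun G _ => whTree n F ∪ G) (fun G _ => G \ whTree n F) ?_ ?_ ?_ ?_ ?_
  · intro G hG
    rw [mem_treesAbove, ← whTree_union]
    refine ⟨(hlink.1 hG).2.isLaminarTree hn, ?_⟩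
    rw [whTree_union]
    exact subset_union_left
  · intro G hG
    obtain ⟨hGt, hFG⟩ := mem_treesAbove.1 hG
    refine hlink.2 ⟨disjoint_sdiff.mono_left subset_whTree, of_isLaminarTree hGt ?_ ?_⟩
    · intro S hS
      rcases mem_union.1 hS with hS | hS
      · exact hFG (subset_whTree hS)
      · exact (mem_sdiff.1 hS).1
    · intro S hS
      rcases mem_union.1 hS with hS | hS
      · refine ⟨fun e => hF.root_notMem hn (e ▸ hS), ?_⟩
        rintro i - rfl
        have := hF.two_le_card hS
        simp at this
      · have := (mem_sdiff.1 hS).2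
        rw [mem_whTree] at this
        push Not at this
        exact ⟨this.1, this.2.2⟩
  · intro G hG
    exact union_sdiff_cancel_left (hdisj hG)
  · intro G hG
    exact union_sdiff_of_subset (mem_treesAbove.1 hG).2
  · intro G hG
    rw [card_union_of_disjoint (hdisj hG), pow_add]

end IsWhFace

end Whitehouse

end LaminarTrees

/-- Euler-characteristic form of: the link of a face `F` of `Δ_n` is a wedge of
`(c-1)! ⬝ ∏_{T ∈ F} (c(T)-1)!` spheres of dimension `n-4-|F|`. -/
theorem stmt14 (n : ℕ) (hn : 3 ≤ n) (F : Finset (Finset ℕ)) (hF : IsWhFace n F) :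
    ∑ G ∈ whLinkFaces n F, (-1 : ℤ) ^ G.card =
      (-1 : ℤ) ^ (n - 3 - F.card) *
        (Nat.factorial (whComps n F - 1) *
          ∏ T ∈ F, Nat.factorial (whChildren F T - 1)) := by
  have htree := hF.isLaminarTree hn
  have hcard := htree.card_le
  rw [hF.card_whTree hn, Nat.card_Icc] at hcard
  have hsum := htree.sum_treesAbove
  rw [hF.sum_whLinkFaces hn, hF.prod_whTree hn] at hsum
  push_cast
  obtain ⟨k, hk⟩ : ∃ k, n = 3 + F.card + k := ⟨n - 3 - F.card, by omega⟩
  have hsq : (-1 : ℤ) ^ (n + F.card) * (-1) ^ (n + F.card) = 1 := by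
    rw [← mul_pow]
    simp
  have hsign : (-1 : ℤ) ^ (n - 3 - F.card) = -(-1) ^ (n + F.card) := by
    rw [show n - 3 - F.card = k by omega,
      show n + F.card = k + 2 * (F.card + 1) + 1 by omega, pow_succ,
      pow_add, pow_mul]
    simp
  rw [hsign]
  calc ∑ G ∈ whLinkFaces n F, (-1 : ℤ) ^ G.card
      = (-1) ^ (n + F.card) * ((-1) ^ (n + F.card) * ∑ G ∈ whLinkFaces n F, (-1 : ℤ) ^ G.card) := by
        rw [← mul_assoc, hsq, one_mul]
    _ = _ := by
        rw [hsum]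
        ring
end
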